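/- arXiv:1205.1252 — 3 statements merged into one kernel-verified Lean document; each statement's English description precedes it below -/
import Mathlib

section
/- Let p(n) denote the number of partitions of n and for a partition λ of n let rk(λ) = λ₁ − l(λ) be its rank (largest part minus number of parts). Then for every real x, (1/p(n)) · |{λ ∈ 𝒫(n) : rk(λ) ≤ x·√(6n)}| converges as n → ∞ to 1/(1 + e^{−πx}). -/
open Filter Real

/-- The rank of a partition: largest part minus number of parts. -/
def Nat.Partition.rank {n : ℕ} (P : n.Partition) : ℤ :=
  (P.parts.sup : ℤ) - (Multiset.card P.parts : ℤ)

/-- The number of partitions of `n`. -/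
noncomputable def partitionCount (n : ℕ) : ℕ := Nat.card (Nat.Partition n)

namespace Nat.Partition

theorem partitionCount_pos (n : ℕ) : 0 < partitionCount n :=
  Nat.card_pos

/-- Adding `m` copies of a part `v`. -/
def addReplicate {k n : ℕ} (m v : ℕ) (hv : 0 < v) (h : k + m * v = n) (P : k.Partition) :
    n.Partition where
  parts := P.parts + Multiset.replicate m v
  parts_pos {i} hi := by
    rcases Multiset.mem_add.1 hi with hi | hi
    · exact P.parts_pos hi
    · exact (Multiset.eq_of_mem_replicate hi) ▸ hv
  parts_sum := by simp [P.parts_sum, h]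

/-- Partitions in which `v` occurs at least `m` times are obtained by adding `m` copies of `v`. -/
def replicateLeEquiv {k n : ℕ} (m v : ℕ) (hv : 0 < v) (h : k + m * v = n) :
    k.Partition ≃ {P : n.Partition // m ≤ P.parts.count v} where
  toFun P := ⟨addReplicate m v hv h P, by simp [addReplicate]⟩
  invFun P :=
    { parts := P.1.parts - Multiset.replicate m v
      parts_pos := fun hi => P.1.parts_pos (Multiset.mem_of_le (Multiset.sub_le_self _ _) hi)
      parts_sum := by
        have h1 := congrArg Multiset.sum
          (Multiset.sub_add_cancel (Multiset.le_count_iff_replicate_le.1 P.2))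
        rw [Multiset.sum_add, P.1.parts_sum, Multiset.sum_replicate, smul_eq_mul] at h1
        omega }
  left_inv P := by ext1; simp [addReplicate]
  right_inv P := by
    apply Subtype.ext
    ext1
    exact Multiset.sub_add_cancel (Multiset.le_count_iff_replicate_le.1 P.2)

theorem partitionCount_mono : Monotone partitionCount := by
  refine monotone_nat_of_le_succ fun n => ?_
  rw [partitionCount, partitionCount, Nat.card_congr (replicateLeEquiv 1 1 one_pos (k := n) rfl)]
  exact Nat.card_le_card_of_injective _ Subtype.val_injective

theorem card_le_count (n : ℕ) {m v : ℕ} (hv : 0 < v) :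
    Nat.card {P : n.Partition // m ≤ P.parts.count v} =
      if m * v ≤ n then partitionCount (n - m * v) else 0 := by
  split_ifs with h
  · exact (Nat.card_congr (replicateLeEquiv m v hv (Nat.sub_add_cancel h))).symm
  · have : IsEmpty {P : n.Partition // m ≤ P.parts.count v} := by
      refine ⟨fun P => h ?_⟩
      have h1 := congrArg Multiset.sum
        (Multiset.sub_add_cancel (Multiset.le_count_iff_replicate_le.1 P.2))
      rw [Multiset.sum_add, P.1.parts_sum, Multiset.sum_replicate, smul_eq_mul] at h1
      omega
    exact Nat.card_of_isEmpty

theorem sum_eq_sum_sum_le_count {n : ℕ} (P : n.Partition) :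
    n = ∑ v ∈ Finset.Icc 1 n, ∑ m ∈ Finset.Icc 1 n, if m ≤ P.parts.count v then v else 0 := by
  conv_lhs => rw [← P.parts_sum]
  rw [Finset.sum_multiset_count_of_subset P.parts (Finset.Icc 1 n)]
  · refine Finset.sum_congr rfl fun v hv => ?_
    have hle : P.parts.count v ≤ n := by
      have h1 := congrArg Multiset.sum
        (Multiset.sub_add_cancel (Multiset.le_count_iff_replicate_le.1 (le_refl (P.parts.count v))))
      rw [Multiset.sum_add, P.parts_sum, Multiset.sum_replicate, smul_eq_mul] at h1
      have := Nat.le_mul_of_pos_right (P.parts.count v) (Finset.mem_Icc.1 hv).1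
      omega
    rw [← Finset.sum_filter, Finset.sum_const, smul_eq_mul, smul_eq_mul]
    congr 1
    have : (Finset.Icc 1 n).filter (· ≤ P.parts.count v) = Finset.Icc 1 (P.parts.count v) := by
      ext; simp; omega
    simp [this]
  · intro v hv
    rw [Multiset.mem_toFinset] at hv
    exact Finset.mem_Icc.2 ⟨P.parts_pos hv, le_of_mem_parts hv⟩

theorem sum_divisors_eq_sum_sum {n k : ℕ} (hk : k ∈ Finset.Icc 1 n) :
    ∑ d ∈ k.divisors, d =
      ∑ v ∈ Finset.Icc 1 n, ∑ m ∈ Finset.Icc 1 n, if m * v = k then v else 0 := by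
  obtain ⟨h1, h2⟩ := Finset.mem_Icc.1 hk
  have hsub : k.divisors ⊆ Finset.Icc 1 n := fun d hd =>
    Finset.mem_Icc.2 ⟨Nat.pos_of_mem_divisors hd, (Nat.divisor_le hd).trans h2⟩
  rw [← Finset.sum_subset hsub (f := fun v => ∑ m ∈ Finset.Icc 1 n, if m * v = k then v else 0)]
  · refine Finset.sum_congr rfl fun d hd => ?_
    have hd0 := Nat.pos_of_mem_divisors hd
    have hdv := Nat.dvd_of_mem_divisors hd
    rw [Finset.sum_eq_single (k / d)]
    · rw [if_pos (Nat.div_mul_cancel hdv)]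
    · intro m _ hm
      rw [if_neg]
      rintro rfl
      exact hm (Nat.mul_div_cancel _ hd0).symm
    · intro h
      exact absurd (Finset.mem_Icc.2
        ⟨Nat.div_pos (Nat.divisor_le hd) hd0, (Nat.div_le_self _ _).trans h2⟩) h
  · intro v _ hv
    refine Finset.sum_eq_zero fun m _ => if_neg ?_
    rintro rfl
    exact hv (Nat.mem_divisors.2 ⟨Dvd.intro_left _ rfl, by omega⟩)

/-- Euler's recurrence `n p(n) = ∑ σ(k) p(n - k)`. -/
theorem mul_partitionCount (n : ℕ) :
    n * partitionCount n =
      ∑ k ∈ Finset.Icc 1 n, (∑ d ∈ k.divisors, d) * partitionCount (n - k) := by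
  have h1 : n * partitionCount n = ∑ P : n.Partition, n := by
    simp [partitionCount, mul_comm]
  have h2 : ∑ P : n.Partition, n = ∑ v ∈ Finset.Icc 1 n, ∑ m ∈ Finset.Icc 1 n,
      if m * v ≤ n then v * partitionCount (n - m * v) else 0 := by
    rw [Finset.sum_congr rfl fun P _ => sum_eq_sum_sum_le_count P, Finset.sum_comm]
    refine Finset.sum_congr rfl fun v hv => ?_
    rw [Finset.sum_comm]
    refine Finset.sum_congr rfl fun m _ => ?_
    have h := card_le_count n (m := m) (Finset.mem_Icc.1 hv).1
    rw [← Finset.sum_filter, Finset.sum_const, smul_eq_mul, ← Fintype.card_subtype,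
      ← Nat.card_eq_fintype_card, h]
    split_ifs
    · exact mul_comm _ _
    · simp
  rw [h1, h2]
  have h3 : ∀ k ∈ Finset.Icc 1 n, (∑ d ∈ k.divisors, d) * partitionCount (n - k) =
      ∑ v ∈ Finset.Icc 1 n, ∑ m ∈ Finset.Icc 1 n,
        if m * v = k then v * partitionCount (n - k) else 0 := by
    intro k hk
    rw [sum_divisors_eq_sum_sum hk]
    simp only [Finset.sum_mul, ite_mul, zero_mul]
  rw [Finset.sum_congr rfl h3]
  refine Eq.trans ?_ Finset.sum_comm
  refine Finset.sum_congr rfl fun v hv => ?_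
  refine Eq.trans ?_ Finset.sum_comm
  refine Finset.sum_congr rfl fun m hm => ?_
  rw [Finset.sum_ite_eq]
  have : 0 < m * v := Nat.mul_pos (Finset.mem_Icc.1 hm).1 (Finset.mem_Icc.1 hv).1
  simp only [Finset.mem_Icc, Nat.one_le_iff_ne_zero, this.ne', ne_eq, not_false_eq_true, true_and]

theorem map_pred_filter_map_succ_add_replicate {s : Multiset ℕ} (hs : ∀ i ∈ s, 0 < i) :
    ((s.map (· - 1)).filter (· ≠ 0)).map (· + 1) +
      Multiset.replicate (s.card - ((s.map (· - 1)).filter (· ≠ 0)).card) 1 = s := by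
  induction s using Multiset.induction with
  | empty => simp
  | cons a s ih =>
    have ih := ih fun i hi => hs i (Multiset.mem_cons_of_mem hi)
    have ha := hs a (Multiset.mem_cons_self a s)
    have hcard : ((s.map (· - 1)).filter (· ≠ 0)).card ≤ s.card :=
      (Multiset.card_le_card (Multiset.filter_le _ _)).trans (Multiset.card_map _ _).le
    rw [Multiset.map_cons]
    by_cases h : a - 1 = 0
    · have h1 : a = 1 := by omega
      rw [Multiset.filter_cons_of_neg (p := (· ≠ 0)) _ (by simpa using h), Multiset.card_cons,
        Nat.sub_add_comm hcard, Multiset.replicate_succ, Multiset.add_cons, ih, h1]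
    · rw [Multiset.filter_cons_of_pos (p := (· ≠ 0)) _ h, Multiset.card_cons, Multiset.card_cons,
        Nat.add_sub_add_right, Multiset.map_cons, Multiset.cons_add, ih]
      congr 1
      omega

theorem sum_map_pred_filter {s : Multiset ℕ} (hs : ∀ i ∈ s, 0 < i) :
    ((s.map (· - 1)).filter (· ≠ 0)).sum + s.card = s.sum := by
  induction s using Multiset.induction with
  | empty => simp
  | cons a s ih =>
    have ih := ih fun i hi => hs i (Multiset.mem_cons_of_mem hi)
    have ha := hs a (Multiset.mem_cons_self a s)
    rw [Multiset.map_cons]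
    by_cases h : a - 1 = 0
    · rw [Multiset.filter_cons_of_neg (p := (· ≠ 0)) _ (by simpa using h), Multiset.card_cons, Multiset.sum_cons]
      omega
    · rw [Multiset.filter_cons_of_pos (p := (· ≠ 0)) _ h, Multiset.card_cons, Multiset.sum_cons, Multiset.sum_cons]
      omega

theorem sup_mem {s : Multiset ℕ} (hs : s ≠ 0) : s.sup ∈ s := by
  induction s using Multiset.induction with
  | empty => exact absurd rfl hs
  | cons a s ih =>
    rw [Multiset.sup_cons]
    rcases eq_or_ne s 0 with rfl | h
    · simp
    · rcases le_total a s.sup with h1 | h1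
      · rw [sup_eq_right.2 h1]; exact Multiset.mem_cons_of_mem (ih h)
      · rw [sup_eq_left.2 h1]; exact Multiset.mem_cons_self _ _

theorem parts_ne_zero {n : ℕ} (hn : 0 < n) (P : n.Partition) : P.parts ≠ 0 := by
  intro h
  have := P.parts_sum
  simp [h] at this
  omega

theorem sup_parts_mem {n : ℕ} (hn : 0 < n) (P : n.Partition) : P.parts.sup ∈ P.parts :=
  sup_mem (parts_ne_zero hn P)

theorem le_sup_parts {n : ℕ} (P : n.Partition) {i : ℕ} (hi : i ∈ P.parts) : i ≤ P.parts.sup :=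
  Multiset.le_sup hi

theorem sup_le_card_add_pred {n : ℕ} (P : n.Partition) {r : ℤ} (hP : P.rank ≤ r + 1) :
    (P.parts.sup : ℤ) - 1 ≤ P.parts.card + r := by
  unfold rank at hP
  omega

theorem sup_cons_map_pred_filter {s : Multiset ℕ} {a : ℕ} (h : s.sup ≤ a + 1) :
    (a ::ₘ (s.map (· - 1)).filter (· ≠ 0)).sup = a := by
  rw [Multiset.sup_cons, sup_eq_left]
  refine Multiset.sup_le.2 fun b hb => ?_
  obtain ⟨c, hc, rfl⟩ := Multiset.mem_map.1 (Multiset.mem_of_mem_filter hb)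
  have := Multiset.le_sup hc
  omega

/-- Dyson's map: remove the first column of the Ferrers diagram, of length `l`, and insert a new
largest part `l + r`. -/
def dysonMap {n m : ℕ} {r : ℤ} (hn : 0 < n) (hm : 0 < m) (h : (m : ℤ) = n + r)
    (P : n.Partition) (hP : P.rank ≤ r + 1) : m.Partition where
  parts := (P.parts.card + r).toNat ::ₘ (P.parts.map (· - 1)).filter (· ≠ 0)
  parts_pos {i} hi := by
    rcases Multiset.mem_cons.1 hi with rfl | hi
    · have h1 := sup_le_card_add_pred P hP
      have h2 := P.parts_pos (sup_parts_mem hn P)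
      by_contra h3
      have h4 : P.parts.sup = 1 := by omega
      have h5 : P.parts.sum = P.parts.card := by
        have h6 : P.parts = Multiset.replicate P.parts.card 1 :=
          Multiset.eq_replicate_card.2 fun b hb => by
            have := P.parts_pos hb
            have := P.le_sup_parts hb
            omega
        conv_lhs => rw [h6]
        rw [Multiset.sum_replicate, smul_eq_mul, mul_one]
      rw [P.parts_sum] at h5
      omega
    · exact Nat.pos_of_ne_zero (Multiset.mem_filter.1 hi).2
  parts_sum := by
    have h1 := sum_map_pred_filter fun i => P.parts_pos (i := i)
    have h2 := sup_le_card_add_pred P hP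
    have h3 := P.parts_pos (sup_parts_mem hn P)
    rw [P.parts_sum] at h1
    rw [Multiset.sum_cons]
    omega

/-- The inverse of Dyson's map. -/
def dysonInv {n m : ℕ} {r : ℤ} (hm : 0 < m) (h : (m : ℤ) = n + r)
    (P : m.Partition) (hP : r - 1 ≤ P.rank) : n.Partition where
  parts := (P.parts.erase P.parts.sup).map (· + 1) +
    Multiset.replicate ((P.parts.sup - r).toNat - (P.parts.erase P.parts.sup).card) 1
  parts_pos {i} hi := by
    rcases Multiset.mem_add.1 hi with hi | hi
    · obtain ⟨c, -, rfl⟩ := Multiset.mem_map.1 hi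
      omega
    · rw [Multiset.eq_of_mem_replicate hi]
      exact one_pos
  parts_sum := by
    have h1 := congrArg Multiset.sum (Multiset.cons_erase (sup_parts_mem hm P))
    have h2 := congrArg Multiset.card (Multiset.cons_erase (sup_parts_mem hm P))
    rw [Multiset.sum_cons, P.parts_sum] at h1
    rw [Multiset.card_cons] at h2
    unfold rank at hP
    rw [Multiset.sum_add, Multiset.sum_map_add]
    simp only [Multiset.map_id', Multiset.map_const', Multiset.sum_replicate, smul_eq_mul, mul_one]
    omega

theorem card_dysonInv {n m : ℕ} {r : ℤ} (hm : 0 < m) (h : (m : ℤ) = n + r)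
    (P : m.Partition) (hP : r - 1 ≤ P.rank) :
    ((dysonInv hm h P hP).parts.card : ℤ) = P.parts.sup - r := by
  have h2 := congrArg Multiset.card (Multiset.cons_erase (sup_parts_mem hm P))
  rw [Multiset.card_cons] at h2
  unfold rank at hP
  simp only [dysonInv, Multiset.card_add, Multiset.card_map, Multiset.card_replicate]
  omega

/-- Dyson's bijection between partitions of rank at most `r + 1` and partitions of rank at
least `r - 1`. -/
def dysonEquiv {n m : ℕ} {r : ℤ} (hn : 0 < n) (hm : 0 < m) (h : (m : ℤ) = n + r) :
    {P : n.Partition // P.rank ≤ r + 1} ≃ {P : m.Partition // r - 1 ≤ P.rank} where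
  toFun P := ⟨dysonMap hn hm h P.1 P.2, by
    have h1 := sup_le_card_add_pred P.1 P.2
    have h2 := P.1.parts_pos (sup_parts_mem hn P.1)
    have hcard : ((P.1.parts.map (· - 1)).filter (· ≠ 0)).card ≤ P.1.parts.card :=
      (Multiset.card_le_card (Multiset.filter_le _ _)).trans (Multiset.card_map _ _).le
    rw [rank, dysonMap, sup_cons_map_pred_filter (by omega), Multiset.card_cons]
    omega⟩
  invFun P := ⟨dysonInv hm h P.1 P.2, by
    rw [rank, card_dysonInv]
    have : (dysonInv hm h P.1 P.2).parts.sup ≤ P.1.parts.sup + 1 := by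
      refine Multiset.sup_le.2 fun b hb => ?_
      rcases Multiset.mem_add.1 hb with hb | hb
      · obtain ⟨c, hc, rfl⟩ := Multiset.mem_map.1 hb
        have := P.1.le_sup_parts (Multiset.mem_of_mem_erase hc)
        omega
      · rw [Multiset.eq_of_mem_replicate hb]
        omega
    omega⟩
  left_inv P := by
    apply Subtype.ext
    ext1
    have h1 := sup_le_card_add_pred P.1 P.2
    have h2 := P.1.parts_pos (sup_parts_mem hn P.1)
    have h3 : (dysonMap hn hm h P.1 P.2).parts.sup = (P.1.parts.card + r).toNat :=
      sup_cons_map_pred_filter (by omega)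
    have h4 : (dysonMap hn hm h P.1 P.2).parts.erase (P.1.parts.card + r).toNat =
        (P.1.parts.map (· - 1)).filter (· ≠ 0) := Multiset.erase_cons_head _ _
    have h5 : ((((P.1.parts.card + r).toNat : ℕ) : ℤ) - r).toNat = P.1.parts.card := by omega
    simp only [dysonInv]
    rw [h3, h4, h5]
    exact map_pred_filter_map_succ_add_replicate fun i => P.1.parts_pos (i := i)
  right_inv P := by
    apply Subtype.ext
    ext1
    have h1 := card_dysonInv hm h P.1 P.2
    have h2 : (dysonInv hm h P.1 P.2).parts.map (· - 1) = P.1.parts.erase P.1.parts.sup +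
        Multiset.replicate
          ((P.1.parts.sup - r).toNat - (P.1.parts.erase P.1.parts.sup).card) 0 := by
      simp [dysonInv]
    simp only [dysonMap]
    rw [h1, h2, Multiset.filter_add]
    rw [Multiset.filter_eq_self.2 fun a ha => (P.1.parts_pos (Multiset.mem_of_mem_erase ha)).ne',
      Multiset.filter_eq_nil.2 fun a ha => by simp [Multiset.eq_of_mem_replicate ha], add_zero]
    have h3 : ((P.1.parts.sup : ℤ) - r + r).toNat = P.1.parts.sup := by omega
    rw [h3]
    exact Multiset.cons_erase (sup_parts_mem hm P.1)

theorem card_rank_le_add_card_lt (n : ℕ) (r : ℤ) :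
    Nat.card {P : n.Partition // P.rank ≤ r} + Nat.card {P : n.Partition // r + 1 ≤ P.rank} =
      partitionCount n := by
  classical
  have : ∀ P : n.Partition, r + 1 ≤ P.rank ↔ ¬ P.rank ≤ r := fun P => by omega
  simp only [this]
  rw [partitionCount, Nat.card_eq_fintype_card, Nat.card_eq_fintype_card,
    Nat.card_eq_fintype_card, Fintype.card_subtype_compl]
  exact Nat.add_sub_cancel' (Fintype.card_subtype_le _)

theorem card_le_rank_recurrence (n R : ℕ) (h : R + 1 < n) :
    Nat.card {P : n.Partition // (R : ℤ) ≤ P.rank} +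
      Nat.card {P : (n - (R + 1)).Partition // ((R + 3 : ℕ) : ℤ) ≤ P.rank} =
      partitionCount (n - (R + 1)) := by
  rw [← card_rank_le_add_card_lt _ (R + 2)]
  congr 1
  have e := dysonEquiv (n := n - (R + 1)) (m := n) (r := R + 1) (by omega) (by omega) (by omega)
  rw [show (R : ℤ) + 1 + 1 = R + 2 by ring, show (R : ℤ) + 1 - 1 = R by ring] at e
  exact (Nat.card_congr e).symm

theorem card_rank_le_neg_recurrence (n R : ℕ) (h : R + 1 < n) :
    Nat.card {P : n.Partition // P.rank ≤ -(R : ℤ)} +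
      Nat.card {P : (n - (R + 1)).Partition // P.rank ≤ -((R + 3 : ℕ) : ℤ)} =
      partitionCount (n - (R + 1)) := by
  rw [← card_rank_le_add_card_lt _ (-((R + 3 : ℕ) : ℤ)), add_comm]
  congr 1
  have e := dysonEquiv (n := n) (m := n - (R + 1)) (r := -(R + 1)) (by omega) (by omega) (by omega)
  rw [show -((R : ℤ) + 1) + 1 = -R by ring,
    show -((R : ℤ) + 1) - 1 = -((R + 3 : ℕ) : ℤ) + 1 by push_cast; ring] at e
  exact Nat.card_congr e

end Nat.Partition

theorem sum_Ioc_id (j : ℕ) : ∑ v ∈ Finset.Ioc 0 j, (v : ℝ) = j * (j + 1) / 2 := by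
  induction j with
  | zero => simp
  | succ j ih =>
    rw [Finset.sum_Ioc_succ_top (Nat.zero_le j), ih]
    push_cast
    ring

theorem sum_sum_divisors (K : ℕ) :
    ((∑ k ∈ Finset.range K, ∑ d ∈ (k + 1).divisors, d : ℕ) : ℝ) =
      ∑ m ∈ Finset.Ioc 0 K, ((K / m : ℕ) : ℝ) * ((K / m : ℕ) + 1) / 2 := by
  have h := ArithmeticFunction.sum_Ioc_mul_eq_sum_sum ArithmeticFunction.zeta
    (ArithmeticFunction.pow 1) K
  rw [ArithmeticFunction.zeta_mul_pow_eq_sigma] at h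
  have h1 : ∑ k ∈ Finset.range K, ∑ d ∈ (k + 1).divisors, d =
      ∑ n ∈ Finset.Ioc 0 K, ArithmeticFunction.sigma 1 n := by
    simp only [ArithmeticFunction.sigma_one_apply]
    rw [Finset.range_eq_Ico, Finset.sum_Ico_add' (fun k => ∑ d ∈ k.divisors, d) 0 K 1]
    rfl
  rw [h1, h]
  push_cast
  refine Finset.sum_congr rfl fun m hm => ?_
  rw [← sum_Ioc_id,
    ArithmeticFunction.zeta_apply_ne (Finset.mem_Ioc.1 hm).1.ne']
  simp

theorem tendsto_nat_div_div (m : ℕ) :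
    Tendsto (fun K : ℕ => ((K / m : ℕ) : ℝ) / K) atTop (nhds (1 / m)) := by
  have h := (tendsto_nat_floor_mul_div_atTop (R := ℝ) (a := 1 / m) (by positivity)).comp
    tendsto_natCast_atTop_atTop
  refine h.congr fun K => ?_
  rw [Function.comp_apply, one_div_mul_eq_div, Nat.floor_div_eq_div]

/-- The average order of the sum-of-divisors function. -/
theorem tendsto_sum_sum_divisors_div_sq :
    Tendsto (fun K : ℕ => (∑ k ∈ Finset.range K, ((∑ d ∈ (k + 1).divisors, d : ℕ) : ℝ)) / K ^ 2)
      atTop (nhds (π ^ 2 / 6 / 2)) := by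
  have hz := hasSum_zeta_two
  have key : Tendsto (fun K : ℕ => ∑' m : ℕ, ((K / m : ℕ) : ℝ) * ((K / m : ℕ) + 1) / 2 / K ^ 2)
      atTop (nhds (∑' m : ℕ, (1 : ℝ) / (m : ℝ) ^ 2 / 2)) := by
    refine tendsto_tsum_of_dominated_convergence (bound := fun m : ℕ => (1 : ℝ) / (m : ℝ) ^ 2)
      hz.summable (fun m => ?_) (Eventually.of_forall fun K m => ?_)
    · have h1 := tendsto_nat_div_div m
      have h2 := (h1.mul (h1.add (tendsto_one_div_atTop_nhds_zero_nat (𝕜 := ℝ)))).div_const 2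
      have h3 : 1 / (m : ℝ) * (1 / m + 0) / 2 = 1 / (m : ℝ) ^ 2 / 2 := by ring
      rw [h3] at h2
      refine h2.congr fun K => ?_
      ring
    · rw [Real.norm_of_nonneg (by positivity)]
      rcases Nat.eq_zero_or_pos K with rfl | hK
      · simp
      have h1 : ((K / m : ℕ) : ℝ) ≤ K / m := Nat.cast_div_le
      have h2 : ((K / m : ℕ) : ℝ) * ((K / m : ℕ) + 1) / 2 ≤ ((K / m : ℕ) : ℝ) ^ 2 := by
        rcases Nat.eq_zero_or_pos (K / m) with h | h
        · simp [h]
        · have : (1 : ℝ) ≤ ((K / m : ℕ) : ℝ) := by exact_mod_cast h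
          nlinarith
      have hK' : (0 : ℝ) < K := by exact_mod_cast hK
      rw [div_le_iff₀ (by positivity)]
      calc _ ≤ ((K / m : ℕ) : ℝ) ^ 2 := h2
        _ ≤ ((K : ℝ) / m) ^ 2 := by gcongr
        _ = _ := by ring
  rw [tsum_div_const, hz.tsum_eq] at key
  refine key.congr fun K => ?_
  rw [tsum_eq_sum (s := Finset.Ioc 0 K), ← Finset.sum_div, ← sum_sum_divisors, Nat.cast_sum]
  intro m hm
  have : K / m = 0 := by
    rw [Nat.div_eq_zero_iff]
    simp at hm
    omega
  simp [this]

theorem sum_mul_nonneg_of_antitone {w f : ℕ → ℝ} (hf : Antitone f) (hf0 : ∀ k, 0 ≤ f k)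
    (hw : ∀ K, 0 ≤ ∑ k ∈ Finset.range K, w k) (n : ℕ) :
    0 ≤ ∑ k ∈ Finset.range n, w k * f k := by
  suffices h : f n * ∑ k ∈ Finset.range n, w k ≤ ∑ k ∈ Finset.range n, w k * f k from
    (mul_nonneg (hf0 n) (hw n)).trans h
  induction n with
  | zero => simp
  | succ n ih =>
    calc f (n + 1) * ∑ k ∈ Finset.range (n + 1), w k
        ≤ f n * ∑ k ∈ Finset.range (n + 1), w k :=
          mul_le_mul_of_nonneg_right (hf n.le_succ) (hw _)
      _ = f n * ∑ k ∈ Finset.range n, w k + w n * f n := by rw [Finset.sum_range_succ]; ring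
      _ ≤ _ := by rw [Finset.sum_range_succ]; gcongr

/-- The convolution of `p` with the linear weights `k + 1`. -/
def linearConv (p : ℕ → ℝ) (n : ℕ) : ℝ :=
  ∑ k ∈ Finset.range n, ((k : ℝ) + 1) * p (n - 1 - k)

theorem abs_sum_mul_le {p u : ℕ → ℝ} (hp : ∀ n, 0 ≤ p n) (hmono : Monotone p) {ε C : ℝ}
    (hu : ∀ K, |∑ k ∈ Finset.range (K + 1), u k| ≤
      ε * ∑ k ∈ Finset.range (K + 1), ((k : ℝ) + 1) + C) {n : ℕ} (hn : 0 < n) :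
    |∑ k ∈ Finset.range n, u k * p (n - 1 - k)| ≤ ε * linearConv p n + C * p (n - 1) := by
  have hf : Antitone fun k => p (n - 1 - k) := fun a b hab => hmono (by omega)
  have hδ : ∀ K, ∑ k ∈ Finset.range (K + 1), (if k = 0 then C else 0) = C := by
    intro K
    simp
  have key : ∀ v : ℕ → ℝ, (∀ K, ∑ k ∈ Finset.range (K + 1), v k ≤
      ε * ∑ k ∈ Finset.range (K + 1), ((k : ℝ) + 1) + C) →
      ∑ k ∈ Finset.range n, v k * p (n - 1 - k) ≤ ε * linearConv p n + C * p (n - 1) := by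
    intro v hv
    have h := sum_mul_nonneg_of_antitone
      (w := fun k => ε * ((k : ℝ) + 1) + (if k = 0 then C else 0) - v k) hf (fun _ => hp _)
      (fun K => by
        cases K with
        | zero => simp
        | succ K =>
          rw [Finset.sum_sub_distrib, Finset.sum_add_distrib, hδ, ← Finset.mul_sum]
          linarith [hv K]) n
    simp only [sub_mul, add_mul] at h
    rw [Finset.sum_sub_distrib, Finset.sum_add_distrib] at h
    have h1 : ∑ k ∈ Finset.range n, (if k = 0 then C else 0) * p (n - 1 - k) = C * p (n - 1) := by
      rw [Finset.sum_eq_single_of_mem 0 (Finset.mem_range.2 hn)]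
      · simp
      · intro k _ hk
        simp [hk]
    have h2 : ∑ k ∈ Finset.range n, (ε * (k : ℝ) + ε * 1) * p (n - 1 - k) =
        ε * linearConv p n := by
      rw [linearConv, Finset.mul_sum]
      exact Finset.sum_congr rfl fun k _ => by ring
    simp only [mul_add] at h
    linarith
  refine abs_le.2 ⟨?_, key u fun K => (le_abs_self _).trans (hu K)⟩
  have h := key (fun k => -u k) fun K => by
    rw [Finset.sum_neg_distrib]
    exact (neg_le_abs _).trans (hu K)
  simp only [neg_mul, Finset.sum_neg_distrib] at h
  linarith

theorem sum_range_add_one (K : ℕ) :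
    ∑ k ∈ Finset.range K, ((k : ℝ) + 1) = K * (K + 1) / 2 := by
  induction K with
  | zero => simp
  | succ K ih =>
    rw [Finset.sum_range_succ, ih]
    push_cast
    ring

theorem exists_abs_sum_le {u : ℕ → ℝ}
    (hu : Tendsto (fun K : ℕ => (∑ k ∈ Finset.range K, u k) / K ^ 2) atTop (nhds 0))
    {ε : ℝ} (hε : 0 < ε) : ∃ C, 0 ≤ C ∧ ∀ K, |∑ k ∈ Finset.range (K + 1), u k| ≤
      ε * ∑ k ∈ Finset.range (K + 1), ((k : ℝ) + 1) + C := by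
  have h1 : ∀ᶠ K : ℕ in atTop, |(∑ k ∈ Finset.range K, u k) / K ^ 2| < ε / 2 := by
    have := hu.abs
    rw [abs_zero] at this
    exact this.eventually_lt_const (by positivity)
  obtain ⟨K₀, hK₀⟩ := eventually_atTop.1 h1
  refine ⟨∑ K ∈ Finset.range (K₀ + 1), |∑ k ∈ Finset.range K, u k|,
    Finset.sum_nonneg fun _ _ => abs_nonneg _, fun K => ?_⟩
  have hT : 0 ≤ ∑ k ∈ Finset.range (K + 1), ((k : ℝ) + 1) :=
    Finset.sum_nonneg fun _ _ => by positivity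
  rcases le_total (K + 1) K₀ with h | h
  · have := Finset.single_le_sum (f := fun K => |∑ k ∈ Finset.range K, u k|)
      (fun _ _ => abs_nonneg _) (Finset.mem_range.2 (Nat.lt_succ_of_le h))
    have h2 := mul_nonneg hε.le hT
    linarith
  · have h2 := hK₀ (K + 1) h
    have hpos : (0 : ℝ) < ((K + 1 : ℕ) : ℝ) ^ 2 := by positivity
    rw [abs_div, abs_of_pos hpos, div_lt_iff₀ hpos] at h2
    have h3 : ε / 2 * ((K + 1 : ℕ) : ℝ) ^ 2 ≤ ε * ∑ k ∈ Finset.range (K + 1), ((k : ℝ) + 1) := by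
      rw [sum_range_add_one]
      push_cast
      nlinarith [mul_nonneg hε.le (Nat.cast_nonneg (α := ℝ) K)]
    have h4 : 0 ≤ ∑ K ∈ Finset.range (K₀ + 1), |∑ k ∈ Finset.range K, u k| :=
      Finset.sum_nonneg fun _ _ => abs_nonneg _
    linarith

theorem linearConv_pos {p : ℕ → ℝ} (hp : ∀ n, 0 < p n) {n : ℕ} (hn : 0 < n) :
    0 < linearConv p n :=
  Finset.sum_pos (fun k _ => mul_pos (by positivity) (hp _)) ⟨0, Finset.mem_range.2 hn⟩

theorem tendsto_mul_div_linearConv {p w : ℕ → ℝ} {c : ℝ} (hp : ∀ n, 0 < p n) (hmono : Monotone p)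
    (hrec : ∀ n : ℕ, n * p n = ∑ k ∈ Finset.range n, w k * p (n - 1 - k))
    (hw : Tendsto (fun K : ℕ => (∑ k ∈ Finset.range K, w k) / K ^ 2) atTop (nhds (c / 2))) :
    Tendsto (fun n : ℕ => n * p n / linearConv p n) atTop (nhds c) := by
  set u : ℕ → ℝ := fun k => w k - c * (k + 1) with hu_def
  have hu : Tendsto (fun K : ℕ => (∑ k ∈ Finset.range K, u k) / K ^ 2) atTop (nhds 0) := by
    have h1 : Tendsto (fun K : ℕ => c / 2 * (1 + 1 / (K : ℝ))) atTop (nhds (c / 2 * (1 + 0))) :=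
      ((tendsto_one_div_atTop_nhds_zero_nat (𝕜 := ℝ)).const_add 1).const_mul _
    have h2 := hw.sub h1
    rw [add_zero, mul_one, sub_self] at h2
    refine h2.congr' ?_
    filter_upwards [eventually_gt_atTop 0] with K hK
    have hK' : (K : ℝ) ≠ 0 := by positivity
    rw [hu_def, Finset.sum_sub_distrib, ← Finset.mul_sum, sum_range_add_one]
    field_simp
  have hbound : ∀ ε > 0, ∃ C, 0 ≤ C ∧ ∀ n : ℕ, 0 < n →
      |n * p n - c * linearConv p n| ≤ ε * linearConv p n + C * p n := by
    intro ε hε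
    obtain ⟨C, hC, h⟩ := exists_abs_sum_le hu hε
    refine ⟨C, hC, fun n hn => ?_⟩
    have h1 := abs_sum_mul_le (fun n => (hp n).le) hmono h hn
    have h2 : ∑ k ∈ Finset.range n, u k * p (n - 1 - k) = n * p n - c * linearConv p n := by
      rw [hrec, linearConv, Finset.mul_sum, ← Finset.sum_sub_distrib]
      exact Finset.sum_congr rfl fun k _ => by rw [hu_def]; ring
    rw [h2] at h1
    exact h1.trans (by gcongr; exact hmono (Nat.sub_le n 1))
  have hsmall : Tendsto (fun n : ℕ => p n / linearConv p n) atTop (nhds 0) := by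
    obtain ⟨C, hC, h⟩ := hbound 1 one_pos
    have hlim : Tendsto (fun n : ℕ => (c + 1) / ((n : ℝ) - C)) atTop (nhds 0) :=
      tendsto_const_nhds.div_atTop
        (tendsto_atTop_add_const_right _ (-C) tendsto_natCast_atTop_atTop)
    refine tendsto_of_tendsto_of_tendsto_of_le_of_le' tendsto_const_nhds hlim ?_ ?_
    · filter_upwards [eventually_gt_atTop 0] with n hn
      exact (div_pos (hp n) (linearConv_pos hp hn)).le
    · filter_upwards [eventually_gt_atTop 0,
        tendsto_natCast_atTop_atTop.eventually_gt_atTop C] with n hn hnC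
      have h1 := (abs_le.1 (h n hn)).2
      rw [div_le_div_iff₀ (linearConv_pos hp hn) (sub_pos.2 hnC)]
      linarith
  rw [Metric.tendsto_nhds]
  intro ε hε
  obtain ⟨C, hC, h⟩ := hbound (ε / 2) (half_pos hε)
  have h1 := hsmall.const_mul C
  rw [mul_zero] at h1
  filter_upwards [eventually_gt_atTop 0, h1.eventually_lt_const (half_pos hε)] with n hn h2
  have hQ := linearConv_pos hp hn
  have h3 := h n hn
  rw [Real.dist_eq, div_sub' hQ.ne', abs_div, abs_of_pos hQ, div_lt_iff₀ hQ]
  rw [← mul_div_assoc, div_lt_iff₀ hQ] at h2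
  rw [mul_comm (linearConv p n) c]
  linarith

theorem linearConv_eq_sum (p : ℕ → ℝ) (n : ℕ) :
    linearConv p n = ∑ j ∈ Finset.range n, ((n : ℝ) - j) * p j := by
  rw [linearConv, ← Finset.sum_range_reflect]
  refine Finset.sum_congr rfl fun j hj => ?_
  have hj := Finset.mem_range.1 hj
  rw [Nat.sub_sub, Nat.sub_sub, Nat.cast_sub (by omega), show n - (1 + (n - (1 + j))) = j by omega]
  push_cast
  ring

theorem linearConv_succ (p : ℕ → ℝ) (n : ℕ) :
    linearConv p (n + 1) = linearConv p n + ∑ j ∈ Finset.range (n + 1), p j := by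
  rw [linearConv_eq_sum, linearConv_eq_sum, Finset.sum_range_succ, Finset.sum_range_succ,
    ← add_assoc, ← Finset.sum_add_distrib]
  push_cast
  congr 1
  · exact Finset.sum_congr rfl fun _ _ => by ring
  · ring

theorem tendsto_sqrt_natCast_atTop : Tendsto (fun n : ℕ => √(n : ℝ)) atTop atTop :=
  tendsto_sqrt_atTop.comp tendsto_natCast_atTop_atTop

theorem tendsto_sqrt_div_sqrt_add (b : ℝ) :
    Tendsto (fun n : ℕ => √(n : ℝ) / (√n + b)) atTop (nhds 1) := by
  have h := (tendsto_sqrt_natCast_atTop.const_div_atTop b).const_add 1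
  rw [add_zero] at h
  have h2 := h.inv₀ one_ne_zero
  rw [inv_one] at h2
  refine h2.congr' ?_
  filter_upwards [eventually_gt_atTop 0] with n hn
  have : √(n : ℝ) ≠ 0 := by positivity
  rw [one_add_div this, inv_div]

theorem tendsto_sqrt_succ_sub_sqrt :
    Tendsto (fun n : ℕ => √((n : ℝ) + 1) - √n) atTop (nhds 0) := by
  have h : Tendsto (fun n : ℕ => 1 / √(n : ℝ)) atTop (nhds 0) :=
    tendsto_sqrt_natCast_atTop.const_div_atTop 1
  refine tendsto_of_tendsto_of_tendsto_of_le_of_le' tendsto_const_nhds h ?_ ?_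
  · exact Eventually.of_forall fun n => sub_nonneg.2 (sqrt_le_sqrt (by linarith))
  · filter_upwards [eventually_gt_atTop 0] with n hn
    have hs : 0 < √(n : ℝ) := by positivity
    have h1 : √((n : ℝ) + 1) ^ 2 = n + 1 := sq_sqrt (by positivity)
    have h2 : √(n : ℝ) ^ 2 = n := sq_sqrt (by positivity)
    have h3 : √(n : ℝ) ≤ √((n : ℝ) + 1) := sqrt_le_sqrt (by linarith)
    rw [le_div_iff₀ hs]
    nlinarith

theorem tendsto_sqrt_div_sqrt_succ :
    Tendsto (fun n : ℕ => √(n : ℝ) / √((n : ℝ) + 1)) atTop (nhds 1) := by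
  have h : Tendsto (fun n : ℕ => 1 - (√((n : ℝ) + 1) - √n) * (1 / √((n : ℝ) + 1))) atTop
      (nhds (1 - 0 * 0)) := by
    refine (tendsto_sqrt_succ_sub_sqrt.mul ?_).const_sub 1
    have := (tendsto_sqrt_natCast_atTop.comp (tendsto_add_atTop_nat 1)).const_div_atTop 1
    refine this.congr fun n => ?_
    simp
  rw [zero_mul, sub_zero] at h
  refine h.congr fun n => ?_
  have : √((n : ℝ) + 1) ≠ 0 := by positivity
  field_simp
  ring

theorem tendsto_riccati_coeff {c : ℕ → ℝ} {c₀ : ℝ} (hc : Tendsto c atTop (nhds c₀)) {b : ℝ}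
    (hb : 0 < b) :
    Tendsto (fun n : ℕ => n * (b / (√n + b) - (b / √((n : ℝ) + 1) - c (n + 1) / (n + 1)))) atTop
      (nhds (c₀ - b ^ 2)) := by
  have h1 := tendsto_sqrt_div_sqrt_add b
  have h2 := tendsto_sqrt_div_sqrt_succ
  have h3 := tendsto_sqrt_succ_sub_sqrt
  have h4 := hc.comp (tendsto_add_atTop_nat 1)
  have h := (((h1.mul h2).mul (h3.sub_const b)).const_mul b).add (h4.mul (h2.pow 2))
  have e : b * (1 * 1 * (0 - b)) + c₀ * 1 ^ 2 = c₀ - b ^ 2 := by ring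
  rw [e] at h
  refine h.congr fun n => ?_
  have hs : (n : ℝ) = √(n : ℝ) ^ 2 := (sq_sqrt (by positivity)).symm
  have hs' : (n : ℝ) + 1 = √((n : ℝ) + 1) ^ 2 := (sq_sqrt (by positivity)).symm
  have p1 : √((n : ℝ) + 1) ≠ 0 := by positivity
  have p2 : √(n : ℝ) + b ≠ 0 := by positivity
  simp only [Function.comp_apply]
  have e1 : c (n + 1) / ((n : ℝ) + 1) = c (n + 1) / √((n : ℝ) + 1) ^ 2 := by rw [← hs']
  have e2 : ∀ t : ℝ, (n : ℝ) * t = √(n : ℝ) ^ 2 * t := fun t => by rw [← hs]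
  rw [e1, e2]
  field_simp
  ring

theorem tendsto_riccati_coeff_zero {c : ℕ → ℝ} {c₀ : ℝ} (hc : Tendsto c atTop (nhds c₀)) (b : ℝ) :
    Tendsto (fun n : ℕ => b / √((n : ℝ) + 1) - c (n + 1) / (n + 1)) atTop (nhds 0) := by
  have h1 := (tendsto_sqrt_natCast_atTop.comp (tendsto_add_atTop_nat 1)).const_div_atTop b
  have h2 := (hc.comp (tendsto_add_atTop_nat 1)).div_atTop
    (tendsto_natCast_atTop_atTop.comp (tendsto_add_atTop_nat 1))
  have h := h1.sub h2
  rw [sub_zero] at h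
  refine h.congr fun n => ?_
  simp

theorem riccati_coeff_nonneg {c : ℕ → ℝ} {c₀ : ℝ} (hc : Tendsto c atTop (nhds c₀)) {b : ℝ}
    (hb : 0 < b) :
    ∀ᶠ n : ℕ in atTop, 0 ≤ b / √((n : ℝ) + 1) - c (n + 1) / (n + 1) := by
  have h1 : Tendsto (fun n : ℕ => c (n + 1) / √((n : ℝ) + 1)) atTop (nhds 0) := by
    have := (hc.comp (tendsto_add_atTop_nat 1)).div_atTop
      (tendsto_sqrt_natCast_atTop.comp (tendsto_add_atTop_nat 1))
    refine this.congr fun n => ?_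
    simp
  filter_upwards [h1.eventually_lt_const hb] with n hn
  have hs' : (n : ℝ) + 1 = √((n : ℝ) + 1) * √((n : ℝ) + 1) := (mul_self_sqrt (by positivity)).symm
  have e1 : c (n + 1) / ((n : ℝ) + 1) = c (n + 1) / √((n : ℝ) + 1) / √((n : ℝ) + 1) := by
    rw [div_div, ← hs']
  rw [e1, ← sub_div]
  exact div_nonneg (by linarith) (by positivity)

theorem exists_eventually_le_of_step {D : ℕ → ℝ}
    (h : ∀ᶠ n in atTop, D (n + 1) ≤ max (D n) 0) : ∃ C, ∀ᶠ n in atTop, D n ≤ C := by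
  obtain ⟨N, hN⟩ := eventually_atTop.1 h
  refine ⟨max (D N) 0, eventually_atTop.2 ⟨N, fun n hn => ?_⟩⟩
  induction n, hn using Nat.le_induction with
  | base => exact le_max_left _ _
  | succ n hn ih => exact (hN n hn).trans (max_le ih (le_max_right _ _))

theorem tendsto_logDeriv_of_recurrence {A Q c : ℕ → ℝ} {a : ℝ} (ha : 0 < a)
    (hc : Tendsto c atTop (nhds (a ^ 2))) (hQ : ∀ᶠ n in atTop, 0 < Q n)
    (hQA : ∀ n, Q (n + 1) = Q n + A n)
    (hA : ∀ n : ℕ, A (n + 1) = A n + c (n + 1) / (n + 1) * Q (n + 1))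
    (hlarge : Tendsto (fun n : ℕ => √(n : ℝ) / Q n) atTop (nhds 0)) :
    Tendsto (fun n : ℕ => √(n : ℝ) * (A n / Q n)) atTop (nhds a) := by
  -- one step of the linearised recurrence for `A - b Q / √n`
  have hstep : ∀ b : ℝ, ∀ n : ℕ, A (n + 1) - b / √((n + 1 : ℕ) : ℝ) * Q (n + 1) =
      (1 - (b / √((n : ℝ) + 1) - c (n + 1) / (n + 1))) * (A n - b / √n * Q n) +
      Q n * (b / √n * (1 - (b / √((n : ℝ) + 1) - c (n + 1) / (n + 1))) -
        (b / √((n : ℝ) + 1) - c (n + 1) / (n + 1))) := by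
    intro b n
    rw [hA, hQA]
    push_cast
    ring
  have hfactor : ∀ b > 0, ∀ n : ℕ, 0 < n → ∀ κ : ℝ,
      b / √n * (1 - κ) - κ = (b / (√n + b) - κ) * ((√n + b) / √n) := by
    intro b hb n hn κ
    have : √(n : ℝ) ≠ 0 := by positivity
    have : √(n : ℝ) + b ≠ 0 := by positivity
    field_simp
    ring
  have hdecay : ∀ κ D : ℝ, 0 ≤ κ → κ < 1 → (1 - κ) * D ≤ max D 0 := by
    intro κ D h0 h1
    rcases le_total D 0 with h | h
    · exact (mul_nonpos_of_nonneg_of_nonpos (by linarith) h).trans (le_max_right _ _)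
    · refine le_trans ?_ (le_max_left _ _)
      nlinarith
  have hupper : ∀ b > a, ∃ C, ∀ᶠ n : ℕ in atTop, A n - b / √n * Q n ≤ C := by
    intro b hb
    have hb0 : 0 < b := ha.trans hb
    refine exists_eventually_le_of_step ?_
    filter_upwards [eventually_gt_atTop 0, hQ, riccati_coeff_nonneg hc hb0,
      (tendsto_riccati_coeff_zero hc b).eventually_lt_const one_pos,
      (tendsto_riccati_coeff hc hb0).eventually_lt_const (u := 0) (by nlinarith)]
      with n hn hQn h0 h1 h2
    rw [hstep, hfactor b hb0 n hn]
    refine le_trans ?_ (hdecay _ _ h0 h1)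
    have h3 : b / (√n + b) - (b / √((n : ℝ) + 1) - c (n + 1) / (n + 1)) ≤ 0 :=
      (neg_of_mul_neg_right h2 (by positivity)).le
    have h4 : 0 ≤ (√n + b) / √(n : ℝ) := by positivity
    nlinarith [mul_nonneg hQn.le (mul_nonneg (neg_nonneg.2 h3) h4)]
  have hlower : ∀ b > 0, b < a → ∃ C, ∀ᶠ n : ℕ in atTop, -(A n - b / √n * Q n) ≤ C := by
    intro b hb0 hb
    refine exists_eventually_le_of_step ?_
    filter_upwards [eventually_gt_atTop 0, hQ, riccati_coeff_nonneg hc hb0,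
      (tendsto_riccati_coeff_zero hc b).eventually_lt_const one_pos,
      (tendsto_riccati_coeff hc hb0).eventually_const_lt (u := 0) (by nlinarith)]
      with n hn hQn h0 h1 h2
    rw [hstep, hfactor b hb0 n hn]
    refine le_trans ?_ (hdecay _ _ h0 h1)
    have h3 : 0 ≤ b / (√n + b) - (b / √((n : ℝ) + 1) - c (n + 1) / (n + 1)) :=
      (pos_of_mul_pos_right h2 (by positivity)).le
    have h4 : 0 ≤ (√n + b) / √(n : ℝ) := by positivity
    nlinarith [mul_nonneg hQn.le (mul_nonneg h3 h4)]
  have hratio : ∀ b : ℝ, ∀ n : ℕ, 0 < n → 0 < Q n →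
      √(n : ℝ) * (A n / Q n) = b + (A n - b / √n * Q n) * (√n / Q n) := by
    intro b n hn hQn
    have : √(n : ℝ) ≠ 0 := by positivity
    field_simp
    ring
  refine tendsto_order.2 ⟨fun l hl => ?_, fun u hu => ?_⟩
  · obtain ⟨b, hb1, hb2⟩ := exists_between (max_lt hl ha)
    obtain ⟨C, hC⟩ := hlower b ((le_max_right _ _).trans_lt hb1) hb2
    have hlim := (hlarge.const_mul C).const_sub b
    rw [mul_zero, sub_zero] at hlim
    filter_upwards [eventually_gt_atTop 0, hQ, hC,
      hlim.eventually_const_lt ((le_max_left _ _).trans_lt hb1)] with n hn hQn h1 h2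
    rw [hratio b n hn hQn]
    have h3 : 0 ≤ √(n : ℝ) / Q n := by positivity
    nlinarith
  · obtain ⟨b, hb1, hb2⟩ := exists_between hu
    obtain ⟨C, hC⟩ := hupper b hb1
    have hlim := (hlarge.const_mul C).const_add b
    rw [mul_zero, add_zero] at hlim
    filter_upwards [eventually_gt_atTop 0, hQ, hC, hlim.eventually_lt_const hb2] with n hn hQn h1 h2
    rw [hratio b n hn hQn]
    have h3 : 0 ≤ √(n : ℝ) / Q n := by positivity
    nlinarith

section SqrtScale

variable {m : ℕ → ℕ} {y : ℝ}

theorem tendsto_div_of_div_sqrt (hm : Tendsto (fun n => (m n : ℝ) / √n) atTop (nhds y)) :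
    Tendsto (fun n => (m n : ℝ) / n) atTop (nhds 0) := by
  refine (hm.div_atTop tendsto_sqrt_natCast_atTop).congr fun n => ?_
  rw [div_div, mul_self_sqrt (by positivity)]

theorem eventually_add_lt_of_div_sqrt (hm : Tendsto (fun n => (m n : ℝ) / √n) atTop (nhds y))
    (N : ℕ) : ∀ᶠ n in atTop, m n + N < n := by
  filter_upwards [(tendsto_div_of_div_sqrt hm).eventually_lt_const (u := 1 / 2) (by norm_num),
    eventually_gt_atTop (2 * N), eventually_gt_atTop 0] with n h1 h2 h3
  have h3' : (0 : ℝ) < n := by exact_mod_cast h3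
  rw [div_lt_iff₀ h3'] at h1
  have h2' : (2 : ℝ) * N < n := by exact_mod_cast h2
  have : ((m n + N : ℕ) : ℝ) < n := by push_cast; linarith
  exact_mod_cast this

theorem tendsto_sub_atTop_of_div_sqrt (hm : Tendsto (fun n => (m n : ℝ) / √n) atTop (nhds y)) :
    Tendsto (fun n => n - m n) atTop atTop := by
  refine tendsto_atTop.2 fun N => ?_
  filter_upwards [eventually_add_lt_of_div_sqrt hm N] with n hn
  omega

theorem tendsto_natCast_div_sub (hm : Tendsto (fun n => (m n : ℝ) / √n) atTop (nhds y)) :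
    Tendsto (fun n : ℕ => (n : ℝ) / (n - m n : ℕ)) atTop (nhds 1) := by
  have h := ((tendsto_div_of_div_sqrt hm).const_sub 1).inv₀ (by norm_num)
  rw [sub_zero, inv_one] at h
  refine h.congr' ?_
  filter_upwards [eventually_add_lt_of_div_sqrt hm 0] with n hn
  have hn0 : (n : ℝ) ≠ 0 := by
    have : n ≠ 0 := by omega
    exact_mod_cast this
  rw [Nat.cast_sub (by omega), one_sub_div hn0, inv_div]

theorem abs_sub_sub_le_of_step {F : ℕ → ℝ} {d e : ℝ} {k n : ℕ} (hkn : k ≤ n)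
    (h : ∀ j, k ≤ j → j < n → |F (j + 1) - F j - d| ≤ e) :
    |F n - F k - ((n : ℝ) - k) * d| ≤ ((n : ℝ) - k) * e := by
  induction n, hkn using Nat.le_induction with
  | base => simp
  | succ n hkn ih =>
    have h1 := ih fun j hj hjn => h j hj (hjn.trans n.lt_succ_self)
    have h2 := h n hkn n.lt_succ_self
    have h3 := abs_add_le (F n - F k - ((n : ℝ) - k) * d) (F (n + 1) - F n - d)
    have h4 : F (n + 1) - F k - (((n + 1 : ℕ) : ℝ) - k) * d =
        (F n - F k - ((n : ℝ) - k) * d) + (F (n + 1) - F n - d) := by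
      push_cast; ring
    rw [h4]
    push_cast
    linarith

theorem tendsto_sub_of_sqrt_mul_step {F : ℕ → ℝ} {a : ℝ}
    (hF : Tendsto (fun n : ℕ => √(n : ℝ) * (F (n + 1) - F n)) atTop (nhds a))
    (hm : Tendsto (fun n => (m n : ℝ) / √n) atTop (nhds y)) :
    Tendsto (fun n => F n - F (n - m n)) atTop (nhds (a * y)) := by
  have hy : 0 ≤ y := ge_of_tendsto' hm fun n => by positivity
  have hr : Tendsto (fun n : ℕ => √((n : ℝ) / (n - m n : ℕ))) atTop (nhds 1) := by
    simpa using (tendsto_natCast_div_sub hm).sqrt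
  have hmain : Tendsto (fun n => F n - F (n - m n) - a * (m n / √n)) atTop (nhds 0) := by
    rw [Metric.tendsto_nhds]
    intro ε hε
    set η := ε / (2 * (y + 1)) with hη
    have hη0 : 0 < η := by positivity
    have hηy : y * (η * 1 + |a| * (1 - 1)) < ε := by
      have : η * (2 * (y + 1)) = ε := by rw [hη]; field_simp
      nlinarith
    have hlim := hm.mul ((hr.const_mul η).add ((hr.sub_const 1).const_mul |a|))
    obtain ⟨N, hN⟩ := eventually_atTop.1 (Metric.tendsto_nhds.1 hF η hη0)
    filter_upwards [hlim.eventually_lt_const hηy,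
      eventually_add_lt_of_div_sqrt hm (N + 1)] with n h1 h2
    have hk : N < n - m n := by omega
    set k := n - m n with hkdef
    have hk0 : (0 : ℝ) < k := by
      have : 0 < k := by omega
      exact_mod_cast this
    have hmk : (m n : ℝ) = n - k := by
      rw [hkdef, Nat.cast_sub (by omega)]
      ring
    have hsk : 0 < √(k : ℝ) := by positivity
    have hsn : 0 < √(n : ℝ) := by
      have : (0 : ℝ) < n := by
        have : 0 < n := by omega
        exact_mod_cast this
      positivity
    have hstep : ∀ j, k ≤ j → j < n →
        |F (j + 1) - F j - a / √n| ≤ η / √k + |a| * (1 / √k - 1 / √n) := by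
      intro j hj hjn
      have hkj : √(k : ℝ) ≤ √j := sqrt_le_sqrt (by exact_mod_cast hj)
      have hjn' : √(j : ℝ) ≤ √n := sqrt_le_sqrt (by exact_mod_cast hjn.le)
      have hsj : 0 < √(j : ℝ) := hsk.trans_le hkj
      have h3 := hN j (by omega)
      rw [Real.dist_eq] at h3
      have h4 : F (j + 1) - F j - a / √n =
          (√j * (F (j + 1) - F j) - a) / √j + a * (1 / √j - 1 / √n) := by
        field_simp
        ring
      rw [h4]
      refine (abs_add_le _ _).trans (add_le_add ?_ ?_)
      · rw [abs_div, abs_of_pos hsj]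
        gcongr
      · have h5 : 0 ≤ 1 / √(j : ℝ) - 1 / √n :=
          sub_nonneg.2 (one_div_le_one_div_of_le hsj hjn')
        rw [abs_mul, abs_of_nonneg h5]
        gcongr
    have h3 := abs_sub_sub_le_of_step (by omega) hstep
    rw [← hmk] at h3
    rw [Real.dist_eq, sub_zero]
    have h4 : F n - F k - a * (m n / √n) = F n - F k - m n * (a / √n) := by ring
    rw [h4]
    refine h3.trans_lt ?_
    convert h1 using 1
    rw [sqrt_div (by positivity)]
    field_simp
  have h := hmain.add (hm.const_mul a)
  rw [zero_add] at h
  exact h.congr fun n => by ring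

end SqrtScale

theorem tendsto_log_step {A Q : ℕ → ℝ} {a : ℝ} (hA : ∀ n, 0 < A n) (hQ : ∀ n, 0 < n → 0 < Q n)
    (hQA : ∀ n, Q (n + 1) = Q n + A n)
    (h : Tendsto (fun n : ℕ => √(n : ℝ) * (A n / Q n)) atTop (nhds a)) :
    Tendsto (fun n : ℕ => √(n : ℝ) * (log (Q (n + 1)) - log (Q n))) atTop (nhds a) := by
  have hx0 : Tendsto (fun n => A n / Q n) atTop (nhds 0) := by
    refine (h.div_atTop tendsto_sqrt_natCast_atTop).congr' ?_
    filter_upwards [eventually_gt_atTop 0] with n hn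
    have : √(n : ℝ) ≠ 0 := by positivity
    field_simp
  have hlow : Tendsto (fun n : ℕ => √(n : ℝ) * (A n / Q n) * (1 + A n / Q n)⁻¹) atTop
      (nhds a) := by
    have := h.mul ((hx0.const_add 1).inv₀ (by norm_num))
    simpa using this
  have hval : ∀ n, 0 < n → log (Q (n + 1)) - log (Q n) = log (1 + A n / Q n) := by
    intro n hn
    rw [← log_div (hQ _ n.succ_pos).ne' (hQ n hn).ne', hQA, add_div, div_self (hQ n hn).ne']
  refine tendsto_of_tendsto_of_tendsto_of_le_of_le' hlow h ?_ ?_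
  · filter_upwards [eventually_gt_atTop 0] with n hn
    have hx : 0 < A n / Q n := div_pos (hA n) (hQ n hn)
    rw [hval n hn, mul_assoc]
    refine mul_le_mul_of_nonneg_left ?_ (sqrt_nonneg _)
    have h := one_sub_inv_le_log_of_pos (x := 1 + A n / Q n) (by linarith)
    refine le_trans (le_of_eq ?_) h
    generalize A n / Q n = x at hx
    field_simp
    ring
  · filter_upwards [eventually_gt_atTop 0] with n hn
    have hx : 0 < A n / Q n := div_pos (hA n) (hQ n hn)
    rw [hval n hn]
    refine mul_le_mul_of_nonneg_left ?_ (sqrt_nonneg _)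
    have h := log_le_sub_one_of_pos (x := 1 + A n / Q n) (by linarith)
    linarith

theorem tendsto_sqrt_div_linearConv {p : ℕ → ℝ} (hp : ∀ n, 0 < p n) (hmono : Monotone p) :
    Tendsto (fun n : ℕ => √(n : ℝ) / linearConv p n) atTop (nhds 0) := by
  have h1 := tendsto_sqrt_natCast_atTop.const_div_atTop (2 / p 0)
  refine tendsto_of_tendsto_of_tendsto_of_le_of_le' tendsto_const_nhds h1 ?_ ?_
  · filter_upwards [eventually_gt_atTop 0] with n hn
    exact div_nonneg (sqrt_nonneg _) (linearConv_pos hp hn).le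
  · filter_upwards [eventually_gt_atTop 0] with n hn
    have hn' : (0 : ℝ) < n := by exact_mod_cast hn
    have h2 : p 0 * (n * (n + 1) / 2) ≤ linearConv p n := by
      rw [← sum_range_add_one, Finset.mul_sum, linearConv]
      refine Finset.sum_le_sum fun k _ => ?_
      rw [mul_comm]
      exact mul_le_mul_of_nonneg_left (hmono (Nat.zero_le _)) (by positivity)
    have hs : √(n : ℝ) * √n = n := mul_self_sqrt hn'.le
    rw [div_le_div_iff₀ (linearConv_pos hp hn) (sqrt_pos.2 hn'), hs, div_mul_eq_mul_div,
      le_div_iff₀ (hp 0)]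
    nlinarith [mul_pos (mul_pos (hp 0) hn') hn', hp 0]

theorem tendsto_shift_ratio {p w : ℕ → ℝ} {a : ℝ} (ha : 0 < a) (hp : ∀ n, 0 < p n)
    (hmono : Monotone p)
    (hrec : ∀ n : ℕ, n * p n = ∑ k ∈ Finset.range n, w k * p (n - 1 - k))
    (hw : Tendsto (fun K : ℕ => (∑ k ∈ Finset.range K, w k) / K ^ 2) atTop (nhds (a ^ 2 / 2)))
    {m : ℕ → ℕ} {y : ℝ} (hm : Tendsto (fun n => (m n : ℝ) / √n) atTop (nhds y)) :
    Tendsto (fun n => p (n - m n) / p n) atTop (nhds (exp (-(a * y)))) := by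
  have hc := tendsto_mul_div_linearConv hp hmono hrec hw
  have hQpos : ∀ n, 0 < n → 0 < linearConv p n := fun n => linearConv_pos hp
  have hsum_pos : ∀ n, 0 < ∑ j ∈ Finset.range (n + 1), p j := fun n =>
    Finset.sum_pos (fun _ _ => hp _) ⟨0, by simp⟩
  have hrecA : ∀ n : ℕ, ∑ j ∈ Finset.range (n + 1 + 1), p j = ∑ j ∈ Finset.range (n + 1), p j +
      ((n + 1 : ℕ) : ℝ) * p (n + 1) / linearConv p (n + 1) / (n + 1) * linearConv p (n + 1) := by
    intro n
    have h1 := (hQpos (n + 1) n.succ_pos).ne'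
    have h2 : (n : ℝ) + 1 ≠ 0 := by positivity
    rw [Finset.sum_range_succ _ (n + 1), Nat.cast_succ, div_right_comm, mul_div_cancel_left₀ _ h2,
      div_mul_cancel₀ _ h1]
  have hdiv : Tendsto
      (fun n : ℕ => √(n : ℝ) * ((∑ j ∈ Finset.range (n + 1), p j) / linearConv p n)) atTop
      (nhds a) :=
    tendsto_logDeriv_of_recurrence (A := fun n => ∑ j ∈ Finset.range (n + 1), p j)
      (Q := linearConv p) (c := fun n : ℕ => n * p n / linearConv p n) ha hc
      ((eventually_gt_atTop 0).mono hQpos) (linearConv_succ p) hrecA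
      (tendsto_sqrt_div_linearConv hp hmono)
  have hlog := tendsto_log_step (A := fun n => ∑ j ∈ Finset.range (n + 1), p j)
    (Q := linearConv p) hsum_pos hQpos (linearConv_succ p) hdiv
  have hQratio : Tendsto (fun n => linearConv p (n - m n) / linearConv p n) atTop
      (nhds (exp (-(a * y)))) := by
    refine (tendsto_sub_of_sqrt_mul_step (F := fun n => log (linearConv p n)) hlog hm).neg.rexp.congr' ?_
    filter_upwards [eventually_add_lt_of_div_sqrt hm 0] with n hn
    have hk : 0 < n - m n := by omega
    have hn0 : 0 < n := by omega
    rw [neg_sub, exp_sub, exp_log (hQpos _ hk), exp_log (hQpos _ hn0)]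
  have ha2 : a ^ 2 ≠ 0 := by positivity
  have h := (((hc.comp (tendsto_sub_atTop_of_div_sqrt hm)).div hc ha2).mul
    (tendsto_natCast_div_sub hm)).mul hQratio
  rw [div_self ha2, one_mul, one_mul] at h
  refine h.congr' ?_
  filter_upwards [eventually_add_lt_of_div_sqrt hm 0] with n hn
  have hk : 0 < n - m n := by omega
  have hn0 : 0 < n := by omega
  have hk' : ((n - m n : ℕ) : ℝ) ≠ 0 := by exact_mod_cast hk.ne'
  have hn' : (n : ℝ) ≠ 0 := by exact_mod_cast hn0.ne'
  have h1 := (hQpos _ hk).ne'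
  have h2 := (hQpos _ hn0).ne'
  have h3 := (hp n).ne'
  simp only [Function.comp_apply, Pi.div_apply]
  generalize linearConv p (n - m n) = q at h1
  generalize linearConv p n = q' at h2
  field_simp

theorem tendsto_const_add_div_sqrt {R : ℕ → ℕ} {z : ℝ} (C : ℕ)
    (hR : Tendsto (fun n => (R n : ℝ) / √n) atTop (nhds z)) :
    Tendsto (fun n => ((R n + C : ℕ) : ℝ) / √n) atTop (nhds z) := by
  have h := hR.add (tendsto_sqrt_natCast_atTop.const_div_atTop (C : ℝ))
  rw [add_zero] at h
  refine h.congr fun n => ?_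
  push_cast
  ring

section RankRecurrence

variable {p : ℕ → ℝ} {f : ℕ → ℕ → ℝ} {a : ℝ}

theorem eventually_abs_sub_le_of_recurrence (hp : ∀ n, 0 < p n)
    (hf0 : ∀ n R, 0 ≤ f n R) (hfp : ∀ n R, f n R ≤ p n)
    (hrec : ∀ n R, R + 1 < n → f n R + f (n - (R + 1)) (R + 3) = p (n - (R + 1)))
    (hratio : ∀ (m : ℕ → ℕ) (y : ℝ), Tendsto (fun n => (m n : ℝ) / √n) atTop (nhds y) →
      Tendsto (fun n => p (n - m n) / p n) atTop (nhds (exp (-(a * y)))))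
    {z : ℝ} (K : ℕ) : ∀ (m R : ℕ → ℕ) (y : ℝ),
      Tendsto (fun n => (m n : ℝ) / √n) atTop (nhds y) →
      Tendsto (fun n => (R n : ℝ) / √n) atTop (nhds z) → ∀ δ > 0,
      ∀ᶠ n in atTop, |f (n - m n) (R n) / p n -
        exp (-(a * y)) * (exp (-(a * z)) / (1 + exp (-(a * z))))| ≤
          exp (-(a * y)) * exp (-(a * z)) ^ K + δ := by
  have hE0 : 0 < exp (-(a * z)) := exp_pos _
  set E := exp (-(a * z)) with hE
  induction K with
  | zero =>
    intro m R y hm hR δ hδ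
    filter_upwards [(hratio m y hm).eventually_lt_const (lt_add_of_pos_right _ hδ)] with n hn
    have h1 : 0 ≤ f (n - m n) (R n) / p n := div_nonneg (hf0 _ _) (hp n).le
    have h2 : f (n - m n) (R n) / p n ≤ p (n - m n) / p n :=
      div_le_div_of_nonneg_right (hfp _ _) (hp n).le
    have h3 : 0 ≤ exp (-(a * y)) * (E / (1 + E)) := by positivity
    have h4 : exp (-(a * y)) * (E / (1 + E)) ≤ exp (-(a * y)) :=
      mul_le_of_le_one_right (exp_pos _).le ((div_le_one (by positivity)).2 (by linarith))
    rw [pow_zero, mul_one, abs_le]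
    constructor <;> linarith
  | succ K ih =>
    intro m R y hm hR δ hδ
    have hm' : Tendsto (fun n => ((m n + (R n + 1) : ℕ) : ℝ) / √n) atTop (nhds (y + z)) := by
      refine (hm.add (tendsto_const_add_div_sqrt 1 hR)).congr fun n => ?_
      push_cast
      ring
    have hexp : exp (-(a * (y + z))) = exp (-(a * y)) * E := by
      rw [hE, ← exp_add]
      congr 1
      ring
    have h1 := ih _ _ _ hm' (tendsto_const_add_div_sqrt 3 hR) (δ / 2) (half_pos hδ)
    have h2 := Metric.tendsto_nhds.1 (hratio _ _ hm') (δ / 2) (half_pos hδ)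
    rw [hexp] at h1 h2
    filter_upwards [h1, h2, eventually_add_lt_of_div_sqrt hm' 0] with n h1 h2 h3
    have h4 := hrec (n - m n) (R n) (by omega)
    rw [Nat.sub_sub] at h4
    rw [Real.dist_eq] at h2
    have h5 : f (n - m n) (R n) / p n - exp (-(a * y)) * (E / (1 + E)) =
        (p (n - (m n + (R n + 1))) / p n - exp (-(a * y)) * E) -
        (f (n - (m n + (R n + 1))) (R n + 3) / p n - exp (-(a * y)) * E * (E / (1 + E))) := by
      rw [← h4]
      field_simp
      ring
    rw [h5]
    refine (abs_sub _ _).trans ?_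
    calc _ ≤ δ / 2 + (exp (-(a * y)) * E * E ^ K + δ / 2) := add_le_add h2.le h1
      _ = _ := by ring

theorem tendsto_of_recurrence (hp : ∀ n, 0 < p n)
    (hf0 : ∀ n R, 0 ≤ f n R) (hfp : ∀ n R, f n R ≤ p n)
    (hrec : ∀ n R, R + 1 < n → f n R + f (n - (R + 1)) (R + 3) = p (n - (R + 1)))
    (hratio : ∀ (m : ℕ → ℕ) (y : ℝ), Tendsto (fun n => (m n : ℝ) / √n) atTop (nhds y) →
      Tendsto (fun n => p (n - m n) / p n) atTop (nhds (exp (-(a * y)))))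
    (ha : 0 < a) {z : ℝ} (hz : 0 < z) {R : ℕ → ℕ}
    (hR : Tendsto (fun n => (R n : ℝ) / √n) atTop (nhds z)) :
    Tendsto (fun n => f n (R n) / p n) atTop
      (nhds (exp (-(a * z)) / (1 + exp (-(a * z))))) := by
  rw [Metric.tendsto_nhds]
  intro ε hε
  have hE1 : exp (-(a * z)) < 1 := by
    rw [← exp_zero]; exact exp_lt_exp.2 (neg_neg_of_pos (mul_pos ha hz))
  obtain ⟨K, hK⟩ := exists_pow_lt_of_lt_one (half_pos hε) hE1
  have h := eventually_abs_sub_le_of_recurrence hp hf0 hfp hrec hratio K (fun _ => 0) R 0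
    (by simp) hR (ε / 2) (half_pos hε)
  filter_upwards [h] with n hn
  rw [Real.dist_eq]
  simp only [Nat.sub_zero, mul_zero, neg_zero, exp_zero, one_mul] at hn
  linarith

end RankRecurrence

theorem tendsto_partitionCount_shift_ratio (m : ℕ → ℕ) (y : ℝ)
    (hm : Tendsto (fun n => (m n : ℝ) / √n) atTop (nhds y)) :
    Tendsto (fun n => (partitionCount (n - m n) : ℝ) / partitionCount n) atTop
      (nhds (exp (-(π / √6 * y)))) := by
  have h6 : (π / √6) ^ 2 = π ^ 2 / 6 := by rw [div_pow, sq_sqrt (by norm_num)]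
  refine tendsto_shift_ratio (p := fun n => (partitionCount n : ℝ))
    (w := fun k => ((∑ d ∈ (k + 1).divisors, d : ℕ) : ℝ)) (by positivity)
    (fun n => by exact_mod_cast Nat.Partition.partitionCount_pos n)
    (fun i j h => Nat.cast_le.2 (Nat.Partition.partitionCount_mono h)) (fun n => ?_)
    (h6 ▸ tendsto_sum_sum_divisors_div_sq) hm
  have h := Nat.Partition.mul_partitionCount n
  have h1 : ∑ k ∈ Finset.Icc 1 n, (∑ d ∈ k.divisors, d) * partitionCount (n - k) =
      ∑ k ∈ Finset.range n, (∑ d ∈ (k + 1).divisors, d) * partitionCount (n - 1 - k) := by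
    rw [Finset.range_eq_Ico]
    simp only [Nat.sub_sub, add_comm 1]
    rw [Finset.sum_Ico_add' (fun k => (∑ d ∈ k.divisors, d) * partitionCount (n - k)) 0 n 1]
    rfl
  rw [h1] at h
  exact_mod_cast h

namespace Nat.Partition

theorem card_subtype_le_partitionCount {n : ℕ} (q : n.Partition → Prop) :
    Nat.card {P : n.Partition // q P} ≤ partitionCount n :=
  Nat.card_le_card_of_injective _ Subtype.val_injective

theorem tendsto_card_le_rank {z : ℝ} (hz : 0 < z) {R : ℕ → ℕ}
    (hR : Tendsto (fun n => (R n : ℝ) / √n) atTop (nhds z)) :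
    Tendsto (fun n => (Nat.card {P : n.Partition // (R n : ℤ) ≤ P.rank} : ℝ) / partitionCount n)
      atTop (nhds (exp (-(π / √6 * z)) / (1 + exp (-(π / √6 * z))))) :=
  tendsto_of_recurrence (p := fun n => (partitionCount n : ℝ))
    (f := fun n R => (Nat.card {P : n.Partition // (R : ℤ) ≤ P.rank} : ℝ))
    (fun n => by exact_mod_cast partitionCount_pos n) (fun _ _ => Nat.cast_nonneg _)
    (fun _ _ => by exact_mod_cast card_subtype_le_partitionCount _)
    (fun n R h => by exact_mod_cast card_le_rank_recurrence n R h)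
    tendsto_partitionCount_shift_ratio (by positivity) hz hR

theorem tendsto_card_rank_le_neg {z : ℝ} (hz : 0 < z) {R : ℕ → ℕ}
    (hR : Tendsto (fun n => (R n : ℝ) / √n) atTop (nhds z)) :
    Tendsto (fun n => (Nat.card {P : n.Partition // P.rank ≤ -(R n : ℤ)} : ℝ) / partitionCount n)
      atTop (nhds (exp (-(π / √6 * z)) / (1 + exp (-(π / √6 * z))))) :=
  tendsto_of_recurrence (p := fun n => (partitionCount n : ℝ))
    (f := fun n R => (Nat.card {P : n.Partition // P.rank ≤ -(R : ℤ)} : ℝ))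
    (fun n => by exact_mod_cast partitionCount_pos n) (fun _ _ => Nat.cast_nonneg _)
    (fun _ _ => by exact_mod_cast card_subtype_le_partitionCount _)
    (fun n R h => by exact_mod_cast card_rank_le_neg_recurrence n R h)
    tendsto_partitionCount_shift_ratio (by positivity) hz hR

end Nat.Partition

theorem tendsto_floor_mul_sqrt {x : ℝ} (hx : 0 ≤ x) :
    Tendsto (fun n : ℕ => (⌊x * √(6 * n)⌋₊ : ℝ) / √n) atTop (nhds (x * √6)) := by
  refine ((tendsto_nat_floor_mul_div_atTop (R := ℝ) (a := x * √6) (by positivity)).comp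
    tendsto_sqrt_natCast_atTop).congr fun n => ?_
  rw [Function.comp_apply, sqrt_mul (by norm_num), mul_assoc]

theorem tendsto_ceil_mul_sqrt {x : ℝ} (hx : 0 ≤ x) :
    Tendsto (fun n : ℕ => (⌈x * √(6 * n)⌉₊ : ℝ) / √n) atTop (nhds (x * √6)) := by
  refine ((tendsto_nat_ceil_mul_div_atTop (R := ℝ) (a := x * √6) (by positivity)).comp
    tendsto_sqrt_natCast_atTop).congr fun n => ?_
  rw [Function.comp_apply, sqrt_mul (by norm_num), mul_assoc]

theorem pi_div_sqrt_six_mul (x : ℝ) : π / √6 * (x * √6) = π * x := by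
  have : √(6 : ℝ) ≠ 0 := by positivity
  field_simp

theorem rank_limit_logistic_of_pos {x : ℝ} (hx : 0 < x) :
    Tendsto
      (fun n : ℕ => (Nat.card {P : n.Partition // (P.rank : ℝ) ≤ x * √(6 * n)} : ℝ)
        / (partitionCount n : ℝ))
      atTop (nhds (1 / (1 + exp (-π * x)))) := by
  have h := (Nat.Partition.tendsto_card_le_rank (by positivity)
    (tendsto_const_add_div_sqrt 1 (tendsto_floor_mul_sqrt hx.le))).const_sub 1
  rw [pi_div_sqrt_six_mul, one_sub_div (by positivity), add_sub_cancel_right, ← neg_mul] at h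
  refine h.congr fun n => ?_
  have h1 := Nat.Partition.card_rank_le_add_card_lt n ⌊x * √(6 * n)⌋₊
  have h2 : ∀ P : n.Partition, (P.rank : ℝ) ≤ x * √(6 * n) ↔ P.rank ≤ (⌊x * √(6 * n)⌋₊ : ℤ) := by
    intro P
    rw [Int.natCast_floor_eq_floor (by positivity), Int.le_floor]
  have hp : (partitionCount n : ℝ) ≠ 0 := by
    exact_mod_cast (Nat.Partition.partitionCount_pos n).ne'
  simp only [h2]
  rw [one_sub_div hp, ← h1]
  push_cast
  rw [add_sub_cancel_right]

theorem rank_limit_logistic_of_neg {x : ℝ} (hx : x < 0) :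
    Tendsto
      (fun n : ℕ => (Nat.card {P : n.Partition // (P.rank : ℝ) ≤ x * √(6 * n)} : ℝ)
        / (partitionCount n : ℝ))
      atTop (nhds (1 / (1 + exp (-π * x)))) := by
  have hx' : 0 < -x := neg_pos.2 hx
  have h := Nat.Partition.tendsto_card_rank_le_neg (by positivity)
    (tendsto_ceil_mul_sqrt hx'.le)
  have e : exp (-(π * -x)) / (1 + exp (-(π * -x))) = 1 / (1 + exp (-π * x)) := by
    rw [mul_neg, neg_neg, neg_mul, exp_neg]
    have := (exp_pos (π * x)).ne'
    field_simp
    ring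
  rw [pi_div_sqrt_six_mul, e] at h
  refine h.congr fun n => ?_
  have h2 : ∀ P : n.Partition,
      (P.rank : ℝ) ≤ x * √(6 * n) ↔ P.rank ≤ -(⌈-x * √(6 * n)⌉₊ : ℤ) := by
    intro P
    rw [Int.natCast_ceil_eq_ceil (by positivity), neg_mul, Int.ceil_neg, neg_neg, Int.le_floor]
  simp only [h2]

theorem rank_limit_logistic (x : ℝ) :
    Tendsto
      (fun n : ℕ =>
        (Nat.card {P : n.Partition // (P.rank : ℝ) ≤ x * Real.sqrt (6 * n)} : ℝ)
          / (partitionCount n : ℝ))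
      atTop (nhds (1 / (1 + Real.exp (-π * x)))) := by
  rcases lt_trichotomy x 0 with hx | rfl | hx
  · exact rank_limit_logistic_of_neg hx
  · have hcont : Continuous fun t : ℝ => 1 / (1 + exp (-π * t)) :=
      continuous_const.div (by fun_prop) fun t => by positivity
    have hmono : ∀ s t : ℝ, s ≤ t → ∀ n : ℕ,
        (Nat.card {P : n.Partition // (P.rank : ℝ) ≤ s * √(6 * n)} : ℝ) / partitionCount n ≤
        (Nat.card {P : n.Partition // (P.rank : ℝ) ≤ t * √(6 * n)} : ℝ) / partitionCount n := by
      intro s t hst n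
      have : s * √(6 * (n : ℝ)) ≤ t * √(6 * n) := by gcongr
      refine div_le_div_of_nonneg_right (Nat.cast_le.2 ?_) (Nat.cast_nonneg _)
      exact Nat.card_le_card_of_injective (Subtype.map id fun P hP => le_trans hP this)
        (Subtype.map_injective _ Function.injective_id)
    refine tendsto_order.2 ⟨fun l hl => ?_, fun u hu => ?_⟩
    · obtain ⟨t, ht, ht0⟩ := (((hcont.tendsto 0).eventually_const_lt hl).filter_mono
        nhdsWithin_le_nhds |>.and (self_mem_nhdsWithin (s := Set.Iio 0))).exists
      filter_upwards [(rank_limit_logistic_of_neg ht0).eventually_const_lt ht] with n hn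
      exact hn.trans_le (hmono t 0 (le_of_lt ht0) n)
    · obtain ⟨t, ht, ht0⟩ := (((hcont.tendsto 0).eventually_lt_const hu).filter_mono
        nhdsWithin_le_nhds |>.and (self_mem_nhdsWithin (s := Set.Ioi 0))).exists
      filter_upwards [(rank_limit_logistic_of_pos ht0).eventually_lt_const ht] with n hn
      exact (hmono 0 t (le_of_lt ht0) n).trans_lt hn
  · exact rank_limit_logistic_of_pos hx
end

section
/- If W₁ and W₂ are independent real-valued random variables each with the Gumbel distribution (density e^{−e^{−x}−x} on ℝ), then for every real t ≠ 0, E(e^{it(W₁−W₂)}) = tπ/sinh(tπ). -/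
open MeasureTheory Real

/-- The exponential moments of the Gumbel distribution are values of the Gamma function. -/
theorem integral_cexp_gumbel (z : ℂ) (hz : z.re < 1) :
    ∫ x, Complex.exp (z * x)
        ∂(volume.withDensity fun x : ℝ => ENNReal.ofReal (Real.exp (-Real.exp (-x) - x)))
      = Complex.Gamma (1 - z) := by
  have himage : (fun x : ℝ => Real.exp (-x)) '' Set.univ = Set.Ioi 0 := by
    ext y
    simp only [Set.image_univ, Set.mem_range, Set.mem_Ioi]
    exact ⟨fun ⟨x, hx⟩ => hx ▸ Real.exp_pos _, fun hy => ⟨-Real.log y, by simp [Real.exp_log hy]⟩⟩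
  have hderiv (x : ℝ) : HasDerivAt (fun x : ℝ => Real.exp (-x)) (-Real.exp (-x)) x := by
    simpa using (hasDerivAt_neg x).exp
  have hinj : Set.InjOn (fun x : ℝ => Real.exp (-x)) Set.univ := fun x _ y _ h => by simpa using h
  rw [Complex.Gamma_eq_integral (by simpa using hz), Complex.GammaIntegral, ← himage,
    integral_image_eq_integral_abs_deriv_smul MeasurableSet.univ
      (fun x _ => (hderiv x).hasDerivWithinAt) hinj, Measure.restrict_univ,
    integral_withDensity_eq_integral_toReal_smul (by fun_prop) (by simp)]
  congr with x
  have hpow : ((Real.exp (-x) : ℝ) : ℂ) ^ (1 - z - 1) = Complex.exp (z * x) := by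
    rw [Complex.cpow_def_of_ne_zero (by simp), ← Complex.ofReal_log (Real.exp_pos _).le,
      Real.log_exp]
    congr 1
    push_cast
    ring
  rw [hpow, ENNReal.toReal_ofReal (Real.exp_pos _).le, abs_neg, abs_of_pos (Real.exp_pos _),
    sub_eq_add_neg, Real.exp_add]
  simp only [Complex.real_smul]
  push_cast
  ring

theorem gumbel_difference_charFun
    {Ω : Type*} [MeasurableSpace Ω] (μ : Measure Ω) [IsProbabilityMeasure μ]
    (W₁ W₂ : Ω → ℝ) (hW₁ : Measurable W₁) (hW₂ : Measurable W₂)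
    (hindep : ProbabilityTheory.IndepFun W₁ W₂ μ)
    (hG₁ : Measure.map W₁ μ
      = volume.withDensity (fun x => ENNReal.ofReal (Real.exp (-Real.exp (-x) - x))))
    (hG₂ : Measure.map W₂ μ
      = volume.withDensity (fun x => ENNReal.ofReal (Real.exp (-Real.exp (-x) - x))))
    (t : ℝ) (ht : t ≠ 0) :
    ∫ ω, Complex.exp (Complex.I * t * (W₁ ω - W₂ ω)) ∂μ
      = ((t * π / Real.sinh (t * π) : ℝ) : ℂ) := by
  have hmoment (W : Ω → ℝ) (hW : Measurable W)
      (hG : Measure.map W μ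
        = volume.withDensity (fun x => ENNReal.ofReal (Real.exp (-Real.exp (-x) - x))))
      (z : ℂ) (hz : z.re < 1) :
      ∫ ω, Complex.exp (z * W ω) ∂μ = Complex.Gamma (1 - z) := by
    rw [← integral_cexp_gumbel z hz, ← hG, integral_map hW.aemeasurable]
    exact (by fun_prop : Measurable fun x : ℝ => Complex.exp (z * x)).aestronglyMeasurable
  have hsplit (ω : Ω) : Complex.exp (Complex.I * t * (W₁ ω - W₂ ω))
      = Complex.exp (Complex.I * t * W₁ ω) * Complex.exp (-(Complex.I * t) * W₂ ω) := by
    rw [← Complex.exp_add]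
    congr 1
    ring
  have hz : Complex.I * t ≠ 0 := mul_ne_zero Complex.I_ne_zero (by exact_mod_cast ht)
  have hprod : ∫ ω, Complex.exp (Complex.I * t * W₁ ω) * Complex.exp (-(Complex.I * t) * W₂ ω) ∂μ
      = (∫ ω, Complex.exp (Complex.I * t * W₁ ω) ∂μ)
        * ∫ ω, Complex.exp (-(Complex.I * t) * W₂ ω) ∂μ :=
    (hindep.comp (φ := fun x : ℝ => Complex.exp (Complex.I * t * x))
      (ψ := fun x : ℝ => Complex.exp (-(Complex.I * t) * x)) (by fun_prop)
      (by fun_prop)).integral_fun_mul_eq_mul_integral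
      (by fun_prop) (by fun_prop)
  simp_rw [hsplit]
  rw [hprod, hmoment W₁ hW₁ hG₁ _ (by simp), hmoment W₂ hW₂ hG₂ _ (by simp), sub_neg_eq_add,
    add_comm 1 (Complex.I * t), Complex.Gamma_add_one _ hz, mul_left_comm,
    mul_comm (Complex.Gamma (1 - _)), Complex.Gamma_mul_Gamma_one_sub,
    show (π : ℂ) * (Complex.I * t) = (t * π : ℂ) * Complex.I by ring, Complex.sin_mul_I]
  push_cast
  field_simp
end

section
/- (Erdős–Lehner) Let p(n) be the number of partitions of n and for a partition λ of n let λ₁ denote its largest part. Then for every real x, (1/p(n)) · |{λ ∈ 𝒫(n) : (λ₁ − (√(6n)/π)·log(√(6n)/π)) / (√(6n)/π) ≤ x}| converges as n → ∞ to exp(−e^{−x}). -/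
open Filter Real

/-- The largest part of a partition. -/
def Nat.Partition.largestPart {n : ℕ} (P : n.Partition) : ℕ := P.parts.sup

/-- The Bose occupation function `1 / (exp x - 1)`, the mean of the geometric law on `ℕ` with
ratio `exp (-x)`. -/
noncomputable def occ (x : ℝ) : ℝ := (Real.exp x - 1)⁻¹

lemma occ_pos {x : ℝ} (hx : 0 < x) : 0 < occ x := by
  have := Real.add_one_lt_exp hx.ne'
  exact inv_pos.mpr (by linarith)

lemma mul_occ_le {x : ℝ} (hx : 0 < x) : x * occ x ≤ 4 * Real.exp (-(3 / 4 * x)) := by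
  have h1 : x / 4 + 1 ≤ Real.exp (x / 4) := Real.add_one_le_exp _
  have h2 : x + 1 ≤ Real.exp x := Real.add_one_le_exp _
  have h3 : Real.exp (-(3 / 4 * x)) * Real.exp x = Real.exp (x / 4) := by
    rw [← Real.exp_add]; congr 1; ring
  have h4 : 0 < Real.exp x - 1 := by linarith
  rw [occ, ← div_eq_mul_inv, div_le_iff₀ h4]
  have h5 : (1 - Real.exp (-x)) * (1 + x) ≥ x := by
    have h6 : Real.exp (-x) * Real.exp x = 1 := by rw [← Real.exp_add]; simp
    have h7 : Real.exp (-x) * (x + 1) ≤ 1 := by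
      exact (mul_le_mul_of_nonneg_left h2 (Real.exp_pos _).le).trans h6.le
    linarith
  have h8 : Real.exp (-(3 / 4 * x)) = Real.exp (x / 4) * Real.exp (-x) := by
    rw [← Real.exp_add]; congr 1; ring
  have h9 : 4 * Real.exp (-(3 / 4 * x)) * (Real.exp x - 1)
      = 4 * Real.exp (x / 4) * (1 - Real.exp (-x)) := by
    have : Real.exp (-(3 / 4 * x)) * Real.exp x = Real.exp (x / 4) := h3
    rw [mul_sub, mul_assoc, h3, h8]; ring
  rw [h9]
  have h10 : 0 ≤ 1 - Real.exp (-x) := by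
    have : Real.exp (-x) ≤ 1 := Real.exp_le_one_iff.mpr (by linarith)
    linarith
  nlinarith

lemma mul_exp_neg_le {x : ℝ} (c : ℝ) {d : ℝ} (hd : 0 < d) :
    x * Real.exp (-(c * x)) ≤ 1 / d * Real.exp (-((c - d) * x)) := by
  have h1 : d * x ≤ Real.exp (d * x) := by linarith [Real.add_one_le_exp (d * x)]
  have h2 : Real.exp (-((c - d) * x)) = Real.exp (d * x) * Real.exp (-(c * x)) := by
    rw [← Real.exp_add]; congr 1; ring
  rw [h2, ← mul_assoc]
  refine mul_le_mul_of_nonneg_right ?_ (Real.exp_pos _).le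
  rw [one_div, inv_mul_eq_div, le_div_iff₀ hd]
  linarith

lemma sq_mul_occ_add_le {x : ℝ} (hx : 0 < x) :
    x ^ 2 * (occ x + occ x ^ 2) ≤ 24 * Real.exp (-(x / 4)) := by
  have h0 := occ_pos hx
  have h1 := mul_occ_le hx
  have h2 : x * Real.exp (-(3 / 4 * x)) ≤ 2 * Real.exp (-(x / 4)) := by
    convert! mul_exp_neg_le (x := x) (3 / 4) (d := 1 / 2) (by norm_num) using 2
    · norm_num
    · congr 1; ring
  have h3 : x ^ 2 * occ x ≤ 8 * Real.exp (-(x / 4)) := by nlinarith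
  have h4 : (x * occ x) ^ 2 ≤ (4 * Real.exp (-(3 / 4 * x))) ^ 2 :=
    pow_le_pow_left₀ (by positivity) h1 2
  have h5 : Real.exp (-(3 / 4 * x)) ^ 2 ≤ Real.exp (-(x / 4)) := by
    rw [← Real.exp_nat_mul]; apply Real.exp_le_exp.mpr; push_cast; linarith
  nlinarith

lemma cube_mul_occ_add_le {x : ℝ} (hx : 0 < x) :
    x ^ 3 * (occ x + occ x ^ 2 + occ x ^ 3) ≤ 192 * Real.exp (-(x / 4)) := by
  have h0 := occ_pos hx
  have h1 := mul_occ_le hx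
  have ha : x * Real.exp (-(3 / 4 * x)) ≤ 4 * Real.exp (-(x / 2)) := by
    convert! mul_exp_neg_le (x := x) (3 / 4) (d := 1 / 4) (by norm_num) using 2
    · norm_num
    · congr 1; ring
  have hb : x * Real.exp (-(x / 2)) ≤ 4 * Real.exp (-(x / 4)) := by
    convert! mul_exp_neg_le (x := x) (1 / 2) (d := 1 / 4) (by norm_num) using 2
    · congr 2; ring
    · norm_num
    · congr 1; ring
  have h3 : x ^ 3 * occ x ≤ 64 * Real.exp (-(x / 4)) := by
    have : x ^ 2 * (x * occ x) ≤ x ^ 2 * (4 * Real.exp (-(3 / 4 * x))) := by gcongr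
    nlinarith
  have h4 : (x * occ x) ^ 2 ≤ (4 * Real.exp (-(3 / 4 * x))) ^ 2 :=
    pow_le_pow_left₀ (by positivity) h1 2
  have h4' : (x * occ x) ^ 3 ≤ (4 * Real.exp (-(3 / 4 * x))) ^ 3 :=
    pow_le_pow_left₀ (by positivity) h1 3
  have h6 : Real.exp (-(3 / 4 * x)) ≤ 1 := Real.exp_le_one_iff.mpr (by linarith)
  have h7 : Real.exp (-(3 / 4 * x)) ≤ Real.exp (-(x / 4)) := by
    apply Real.exp_le_exp.mpr; linarith
  have h8 : Real.exp (-(x / 2)) ≤ Real.exp (-(x / 4)) := by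
    apply Real.exp_le_exp.mpr; linarith
  have hp := Real.exp_pos (-(3 / 4 * x))
  have h9 : Real.exp (-(3 / 4 * x)) ^ 3 ≤ Real.exp (-(x / 4)) := by
    have : Real.exp (-(3 / 4 * x)) ^ 3 ≤ Real.exp (-(3 / 4 * x)) := by
      have := pow_le_pow_of_le_one hp.le h6 (show 1 ≤ 3 by norm_num)
      simpa using this
    linarith
  have h10 : x ^ 3 * occ x ^ 2 ≤ 64 * Real.exp (-(x / 4)) := by
    have e1 : x * (x * occ x) ^ 2 ≤ x * (4 * Real.exp (-(3 / 4 * x))) ^ 2 := by gcongr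
    have e2 : x * (4 * Real.exp (-(3 / 4 * x))) ^ 2
        = 16 * (x * Real.exp (-(3 / 4 * x))) * Real.exp (-(3 / 4 * x)) := by ring
    have e3 : 16 * (x * Real.exp (-(3 / 4 * x))) * Real.exp (-(3 / 4 * x))
        ≤ 16 * (4 * Real.exp (-(x / 2))) * 1 := by gcongr
    nlinarith
  nlinarith

lemma sum_Ico_exp_le {d : ℝ} (hd : 0 < d) {k K : ℕ} (hk : k ≤ K) :
    ∑ j ∈ Finset.Ico k K, Real.exp (-(d * ((j : ℝ) + 1))) ≤ Real.exp (-(d * k)) / d := by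
  have key : ∑ j ∈ Finset.Ico k K, Real.exp (-(d * ((j : ℝ) + 1)))
      ≤ (Real.exp (-(d * k)) - Real.exp (-(d * K))) / d := by
    induction K, hk using Nat.le_induction with
    | base => simp
    | succ n hn ih =>
      rw [Finset.sum_Ico_succ_top hn]
      refine (add_le_add_left ih _).trans ?_
      rw [← sub_nonneg]
      have h1 : d + 1 ≤ Real.exp d := Real.add_one_le_exp d
      have h2 : Real.exp (-(d * n)) = Real.exp d * Real.exp (-(d * ((n : ℝ) + 1))) := by
        rw [← Real.exp_add]; congr 1; ring
      have h3 := Real.exp_pos (-(d * ((n : ℝ) + 1)))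
      push_cast
      have : (Real.exp (-(d * k)) - Real.exp (-(d * ((n : ℝ) + 1)))) / d
          - ((Real.exp (-(d * k)) - Real.exp (-(d * n))) / d + Real.exp (-(d * ((n : ℝ) + 1))))
          = ((Real.exp d - 1 - d) * Real.exp (-(d * ((n : ℝ) + 1)))) / d := by
        rw [h2]; field_simp; ring
      rw [this]
      have : 0 ≤ Real.exp d - 1 - d := by linarith
      positivity
  refine key.trans ?_
  gcongr
  linarith [Real.exp_pos (-(d * K))]

/-- The mean of `∑ j * G j`, the `G j` (`1 ≤ j ≤ K`) being geometric with ratios `exp (-(j * s))`. -/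
noncomputable def meanOcc (K : ℕ) (s : ℝ) : ℝ :=
  ∑ j ∈ Finset.range K, ((j : ℝ) + 1) * occ (((j : ℝ) + 1) * s)

/-- The variance of `∑ j * G j`, the `G j` (`1 ≤ j ≤ K`) being independent geometric with ratios
`exp (-(j * s))`. -/
noncomputable def varOcc (K : ℕ) (s : ℝ) : ℝ :=
  ∑ j ∈ Finset.range K,
    ((j : ℝ) + 1) ^ 2 * (occ (((j : ℝ) + 1) * s) + occ (((j : ℝ) + 1) * s) ^ 2)

lemma sum_Ico_mean_le {s : ℝ} (hs : 0 < s) {k K : ℕ} (hk : k ≤ K) :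
    ∑ j ∈ Finset.Ico k K, ((j : ℝ) + 1) * occ (((j : ℝ) + 1) * s)
      ≤ 16 / 3 / s ^ 2 * Real.exp (-(3 / 4 * s * k)) := by
  calc _ ≤ ∑ j ∈ Finset.Ico k K, 4 / s * Real.exp (-(3 / 4 * s * ((j : ℝ) + 1))) := by
        refine Finset.sum_le_sum fun j _ => ?_
        have := mul_occ_le (x := ((j : ℝ) + 1) * s) (by positivity)
        rw [div_mul_eq_mul_div, le_div_iff₀ hs]
        convert! this using 1
        · ring
        · congr 2; ring
    _ ≤ 4 / s * (Real.exp (-(3 / 4 * s * k)) / (3 / 4 * s)) := by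
        rw [← Finset.mul_sum]
        gcongr
        exact sum_Ico_exp_le (by positivity) hk
    _ = _ := by field_simp; norm_num

lemma sum_Ico_var_le {s : ℝ} (hs : 0 < s) {k K : ℕ} (hk : k ≤ K) :
    ∑ j ∈ Finset.Ico k K,
      ((j : ℝ) + 1) ^ 2 * (occ (((j : ℝ) + 1) * s) + occ (((j : ℝ) + 1) * s) ^ 2)
      ≤ 96 / s ^ 3 * Real.exp (-(1 / 4 * s * k)) := by
  calc _ ≤ ∑ j ∈ Finset.Ico k K, 24 / s ^ 2 * Real.exp (-(1 / 4 * s * ((j : ℝ) + 1))) := by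
        refine Finset.sum_le_sum fun j _ => ?_
        have := sq_mul_occ_add_le (x := ((j : ℝ) + 1) * s) (by positivity)
        rw [div_mul_eq_mul_div, le_div_iff₀ (by positivity)]
        convert! this using 1
        · ring
        · congr 2; ring
    _ ≤ 24 / s ^ 2 * (Real.exp (-(1 / 4 * s * k)) / (1 / 4 * s)) := by
        rw [← Finset.mul_sum]
        gcongr
        exact sum_Ico_exp_le (by positivity) hk
    _ = _ := by field_simp; norm_num

lemma sum_range_cube_le {s : ℝ} (hs : 0 < s) (K : ℕ) :
    ∑ j ∈ Finset.range K,
      ((j : ℝ) + 1) ^ 3 * (occ (((j : ℝ) + 1) * s) + occ (((j : ℝ) + 1) * s) ^ 2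
        + occ (((j : ℝ) + 1) * s) ^ 3)
      ≤ 768 / s ^ 4 := by
  calc _ ≤ ∑ j ∈ Finset.Ico 0 K, 192 / s ^ 3 * Real.exp (-(1 / 4 * s * ((j : ℝ) + 1))) := by
        rw [← Finset.range_eq_Ico]
        refine Finset.sum_le_sum fun j _ => ?_
        have := cube_mul_occ_add_le (x := ((j : ℝ) + 1) * s) (by positivity)
        rw [div_mul_eq_mul_div, le_div_iff₀ (by positivity)]
        convert! this using 1
        · ring
        · congr 2; ring
    _ ≤ 192 / s ^ 3 * (Real.exp (-(1 / 4 * s * (0 : ℕ))) / (1 / 4 * s)) := by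
        rw [← Finset.mul_sum]
        gcongr
        exact sum_Ico_exp_le (by positivity) (Nat.zero_le _)
    _ = _ := by simp; field_simp; norm_num

lemma varOcc_le {s : ℝ} (hs : 0 < s) (K : ℕ) : varOcc K s ≤ 96 / s ^ 3 := by
  have := sum_Ico_var_le hs (Nat.zero_le K)
  simpa [varOcc] using this

lemma half_le_occ {x : ℝ} (hx : 0 < x) (hx1 : x ≤ 1) : 1 / 2 ≤ occ x := by
  have h1 := Real.add_one_lt_exp hx.ne'
  have h2 : Real.exp x ≤ Real.exp 1 := Real.exp_le_exp.mpr hx1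
  have h3 := Real.exp_one_lt_d9
  rw [occ, ← one_div]
  exact one_div_le_one_div_of_le (by linarith) (by linarith)

lemma cube_le_three_mul_sum_sq (J : ℕ) :
    (J : ℝ) ^ 3 ≤ 3 * ∑ j ∈ Finset.range J, ((j : ℝ) + 1) ^ 2 := by
  induction J with
  | zero => simp
  | succ n ih =>
    rw [Finset.sum_range_succ]; push_cast
    have : (0 : ℝ) ≤ n := n.cast_nonneg
    nlinarith

lemma exists_nat_half_inv {s : ℝ} (hs : 0 < s) (hs1 : s ≤ 1) :
    ∃ J : ℕ, 1 / (2 * s) ≤ J ∧ (J : ℝ) * s ≤ 1 := by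
  have h0 : 1 ≤ 1 / s := by rw [le_div_iff₀ hs]; linarith
  refine ⟨⌊1 / s⌋₊, ?_, ?_⟩
  · have h1 := Nat.lt_floor_add_one (1 / s)
    have h2 : (1 : ℝ) ≤ ⌊1 / s⌋₊ := by
      exact_mod_cast Nat.le_floor (by simpa using h0)
    have : 1 / (2 * s) = 1 / s / 2 := by field_simp
    rw [this]; linarith
  · have := Nat.floor_le (show 0 ≤ 1 / s by positivity)
    rwa [le_div_iff₀ hs] at this

lemma le_varOcc {s : ℝ} (hs : 0 < s) (hs1 : s ≤ 1) {K : ℕ} (hK : 1 ≤ K * s) :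
    1 / 32 / s ^ 3 ≤ varOcc K s := by
  obtain ⟨J, hJ1, hJ2⟩ := exists_nat_half_inv hs hs1
  have hJK : J ≤ K := by
    have : (J : ℝ) ≤ K := le_of_mul_le_mul_right (hJ2.trans hK) hs
    exact_mod_cast this
  have hcube : (1 / (2 * s)) ^ 3 ≤ (J : ℝ) ^ 3 := by gcongr
  calc 1 / 32 / s ^ 3 = 3 / 4 * ((1 / (2 * s)) ^ 3 / 3) := by field_simp; norm_num
    _ ≤ 3 / 4 * ∑ j ∈ Finset.range J, ((j : ℝ) + 1) ^ 2 := by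
        have := cube_le_three_mul_sum_sq J
        linarith
    _ ≤ ∑ j ∈ Finset.range J,
        ((j : ℝ) + 1) ^ 2 * (occ (((j : ℝ) + 1) * s) + occ (((j : ℝ) + 1) * s) ^ 2) := by
        rw [Finset.mul_sum]
        refine Finset.sum_le_sum fun j hj => ?_
        have hj' : (j : ℝ) + 1 ≤ J := by exact_mod_cast Finset.mem_range.mp hj
        have := half_le_occ (x := ((j : ℝ) + 1) * s) (by positivity)
          ((mul_le_mul_of_nonneg_right hj' hs.le).trans hJ2)
        rw [mul_comm]
        gcongr
        nlinarith
    _ ≤ varOcc K s := by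
        refine Finset.sum_le_sum_of_subset_of_nonneg (Finset.range_subset_range.mpr hJK) ?_
        intro j _ _
        have := occ_pos (x := ((j : ℝ) + 1) * s) (by positivity)
        positivity

lemma hasSum_succ_mul_geometric {r : ℝ} (hr : |r| < 1) :
    HasSum (fun j : ℕ => ((j : ℝ) + 1) * r ^ (j + 1)) (r / (1 - r) ^ 2) := by
  have h := (hasSum_nat_add_iff' 1).mpr (hasSum_coe_mul_geometric_of_norm_lt_one (𝕜 := ℝ) hr)
  simpa using h

lemma tsum_mul_exp_eq {s : ℝ} (hs : 0 < s) (m : ℕ) :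
    HasSum (fun j : ℕ => ((j : ℝ) + 1) * Real.exp (-(((j : ℝ) + 1) * ((m : ℝ) + 1) * s)))
      (Real.exp (-(((m : ℝ) + 1) * s)) / (1 - Real.exp (-(((m : ℝ) + 1) * s))) ^ 2) := by
  have hr : |Real.exp (-(((m : ℝ) + 1) * s))| < 1 := by
    rw [abs_of_pos (Real.exp_pos _), Real.exp_lt_one_iff]
    have : 0 < ((m : ℝ) + 1) * s := by positivity
    linarith
  have h := hasSum_succ_mul_geometric hr
  have e : ∀ j : ℕ, Real.exp (-(((m : ℝ) + 1) * s)) ^ (j + 1)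
      = Real.exp (-(((j : ℝ) + 1) * ((m : ℝ) + 1) * s)) := fun j => by
    rw [← Real.exp_nat_mul]; push_cast; congr 1; ring
  simpa only [e] using h

lemma hasSum_exp_occ {s : ℝ} (hs : 0 < s) (j : ℕ) :
    HasSum (fun m : ℕ => ((j : ℝ) + 1) * Real.exp (-(((j : ℝ) + 1) * ((m : ℝ) + 1) * s)))
      (((j : ℝ) + 1) * occ (((j : ℝ) + 1) * s)) := by
  refine HasSum.mul_left _ ?_
  have hx : 0 < ((j : ℝ) + 1) * s := by positivity
  have hr0 := Real.exp_pos (-(((j : ℝ) + 1) * s))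
  have hr : Real.exp (-(((j : ℝ) + 1) * s)) < 1 := by
    rw [Real.exp_lt_one_iff]; linarith
  have h := (hasSum_geometric_of_lt_one hr0.le hr).mul_left (Real.exp (-(((j : ℝ) + 1) * s)))
  convert! h using 1
  · ext m
    rw [← Real.exp_nat_mul, ← Real.exp_add]; congr 1; ring
  · rw [occ, ← div_eq_mul_inv, inv_eq_one_div, div_eq_div_iff]
    · rw [mul_sub (Real.exp _), ← Real.exp_add]; simp
    · have := Real.add_one_lt_exp hx.ne'; linarith
    · linarith

lemma exp_neg_div_le {u : ℝ} (hu : 0 < u) :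
    Real.exp (-u) / (1 - Real.exp (-u)) ^ 2 ≤ 1 / u ^ 2 := by
  have h1 : u / 2 ≤ Real.sinh (u / 2) := Real.self_le_sinh_iff.mpr (by positivity)
  have h2 : Real.exp (-u) = Real.exp (-(u / 2)) ^ 2 := by
    rw [← Real.exp_nat_mul]; congr 1; push_cast; ring
  have h3 : 1 - Real.exp (-u) = Real.exp (-(u / 2)) * (2 * Real.sinh (u / 2)) := by
    rw [Real.sinh_eq, mul_div_cancel₀ _ (by norm_num), mul_sub, ← Real.exp_add, h2, pow_two]
    simp
  have hp := Real.exp_pos (-(u / 2))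
  rw [h3, h2, mul_pow, ← div_div, div_self (by positivity)]
  gcongr
  linarith

lemma le_exp_neg_div {u : ℝ} (hu : 0 < u) :
    1 / u ^ 2 - 1 / u ^ (5 / 4 : ℝ) ≤ Real.exp (-u) / (1 - Real.exp (-u)) ^ 2 := by
  have h1 : 1 - u ≤ Real.exp (-u) := by linarith [Real.add_one_le_exp (-u)]
  have h2 : Real.exp (-u) < 1 := by rw [Real.exp_lt_one_iff]; linarith
  have h3 : 1 - u ^ (3 / 4 : ℝ) ≤ Real.exp (-u) := by
    rcases le_total u 1 with h | h
    · have : u ^ (1 : ℝ) ≤ u ^ (3 / 4 : ℝ) :=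
        Real.rpow_le_rpow_of_exponent_ge hu h (by norm_num)
      rw [Real.rpow_one] at this; linarith
    · have : 1 ≤ u ^ (3 / 4 : ℝ) := Real.one_le_rpow h (by norm_num)
      linarith [Real.exp_pos (-u)]
  have h4 : 1 / u ^ 2 - 1 / u ^ (5 / 4 : ℝ) = (1 - u ^ (3 / 4 : ℝ)) / u ^ 2 := by
    have : u ^ 2 = u ^ (3 / 4 : ℝ) * u ^ (5 / 4 : ℝ) := by
      rw [← Real.rpow_add hu, ← Real.rpow_natCast]; norm_num
    have ha : 0 < u ^ (3 / 4 : ℝ) := by positivity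
    have hb : 0 < u ^ (5 / 4 : ℝ) := by positivity
    rw [this]; field_simp
  rw [h4]
  calc _ ≤ Real.exp (-u) / u ^ 2 := by gcongr
    _ ≤ _ := by
      have : 0 < 1 - Real.exp (-u) := by linarith
      gcongr
      linarith

lemma hasSum_inv_succ_mul_sq (s : ℝ) :
    HasSum (fun m : ℕ => 1 / (((m : ℝ) + 1) * s) ^ 2) (π ^ 2 / 6 / s ^ 2) := by
  have h := (hasSum_nat_add_iff' 1).mpr hasSum_zeta_two
  have h' := h.div_const (s ^ 2)
  simpa [mul_pow, div_eq_mul_inv, mul_comm] using h'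

lemma summable_mean_aux {s : ℝ} (hs : 0 < s) :
    Summable fun m : ℕ =>
      Real.exp (-(((m : ℝ) + 1) * s)) / (1 - Real.exp (-(((m : ℝ) + 1) * s))) ^ 2 :=
  Summable.of_nonneg_of_le (fun m => by positivity)
    (fun m => exp_neg_div_le (by positivity)) (hasSum_inv_succ_mul_sq s).summable

lemma hasSum_mean {s : ℝ} (hs : 0 < s) :
    HasSum (fun j : ℕ => ((j : ℝ) + 1) * occ (((j : ℝ) + 1) * s))
      (∑' m : ℕ, Real.exp (-(((m : ℝ) + 1) * s)) / (1 - Real.exp (-(((m : ℝ) + 1) * s))) ^ 2) := by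
  let f : ℕ × ℕ → ℝ := fun p =>
    ((p.2 : ℝ) + 1) * Real.exp (-(((p.2 : ℝ) + 1) * ((p.1 : ℝ) + 1) * s))
  have hf : Summable f := by
    refine (summable_prod_of_nonneg (fun p => ?_)).mpr ⟨fun m => (tsum_mul_exp_eq hs m).summable, ?_⟩
    · simp only [f, Pi.zero_apply]; positivity
    · simp only [f, (tsum_mul_exp_eq hs _).tsum_eq]
      exact summable_mean_aux hs
  have h1 : ∑' p, f p
      = ∑' m : ℕ, Real.exp (-(((m : ℝ) + 1) * s)) / (1 - Real.exp (-(((m : ℝ) + 1) * s))) ^ 2 := by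
    rw [hf.tsum_prod]
    simp only [f, (tsum_mul_exp_eq hs _).tsum_eq]
  have h2 := (Equiv.prodComm ℕ ℕ).hasSum_iff.mpr hf.hasSum
  rw [h1] at h2
  exact h2.prod_fiberwise fun j => hasSum_exp_occ hs j

lemma meanOcc_le {s : ℝ} (hs : 0 < s) (K : ℕ) : meanOcc K s ≤ π ^ 2 / 6 / s ^ 2 := by
  refine (sum_le_hasSum _ (fun j _ => ?_) (hasSum_mean hs)).trans ?_
  · have := occ_pos (x := ((j : ℝ) + 1) * s) (by positivity)
    positivity
  · rw [← (hasSum_inv_succ_mul_sq s).tsum_eq]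
    exact (summable_mean_aux hs).tsum_le_tsum (fun m => exp_neg_div_le (by positivity))
      (hasSum_inv_succ_mul_sq s).summable

lemma le_meanOcc : ∃ C : ℝ, ∀ s : ℝ, 0 < s → ∀ K : ℕ,
    π ^ 2 / 6 / s ^ 2 ≤ meanOcc K s + C / s ^ (5 / 4 : ℝ)
      + 16 / 3 / s ^ 2 * Real.exp (-(3 / 4 * s * K)) := by
  have hZ : Summable fun m : ℕ => 1 / ((m : ℝ) + 1) ^ (5 / 4 : ℝ) := by
    have := (summable_nat_add_iff 1).mpr
      (Real.summable_one_div_nat_rpow (p := 5 / 4)|>.mpr (by norm_num))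
    simpa using this
  refine ⟨∑' m : ℕ, 1 / ((m : ℝ) + 1) ^ (5 / 4 : ℝ), fun s hs K => ?_⟩
  have h1 : ∑' m : ℕ, Real.exp (-(((m : ℝ) + 1) * s)) / (1 - Real.exp (-(((m : ℝ) + 1) * s))) ^ 2
      ≤ meanOcc K s + 16 / 3 / s ^ 2 * Real.exp (-(3 / 4 * s * K)) := by
    rw [← (hasSum_mean hs).tsum_eq]
    refine (hasSum_mean hs).summable.tsum_le_of_sum_range_le fun N => ?_
    have h2 := sum_Ico_mean_le hs (le_max_left K N)
    refine le_trans ?_ (add_le_add_right h2 _)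
    rw [meanOcc, Finset.sum_range_add_sum_Ico _ (le_max_left K N)]
    refine Finset.sum_le_sum_of_subset_of_nonneg
      (Finset.range_subset_range.mpr (le_max_right K N)) fun j _ _ => ?_
    have := occ_pos (x := ((j : ℝ) + 1) * s) (by positivity)
    positivity
  have h3 : HasSum (fun m : ℕ => 1 / (((m : ℝ) + 1) * s) ^ 2 - 1 / (((m : ℝ) + 1) * s) ^ (5 / 4 : ℝ))
      (π ^ 2 / 6 / s ^ 2 - (∑' m : ℕ, 1 / ((m : ℝ) + 1) ^ (5 / 4 : ℝ)) / s ^ (5 / 4 : ℝ)) := by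
    refine (hasSum_inv_succ_mul_sq s).sub ?_
    convert! hZ.hasSum.div_const (s ^ (5 / 4 : ℝ)) using 2 with m
    rw [Real.mul_rpow (by positivity) hs.le, div_div]
  have h4 := hasSum_le (fun m : ℕ => le_exp_neg_div (u := ((m : ℝ) + 1) * s) (by positivity)) h3
    (summable_mean_aux hs).hasSum
  linarith

lemma norm_exp_I_sub_quadratic_le (α : ℝ) :
    ‖Complex.exp (Complex.I * α) - 1 - Complex.I * α‖ ≤ 3 * |α| ^ 2 ∧
    ‖Complex.exp (Complex.I * α) - 1 - Complex.I * α + (α : ℂ) ^ 2 / 2‖ ≤ 4 * |α| ^ 3 := by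
  have hn : ‖Complex.I * (α : ℂ)‖ = |α| := by simp
  have hI : (Complex.I * (α : ℂ)) ^ 2 = -(α : ℂ) ^ 2 := by rw [mul_pow, Complex.I_sq]; ring
  have h0 := abs_nonneg α
  rcases le_total |α| 1 with h | h
  · constructor
    · have := Complex.norm_exp_sub_one_sub_id_le (x := Complex.I * α) (by rw [hn]; exact h)
      rw [hn] at this
      nlinarith
    · have := Complex.exp_bound (x := Complex.I * α) (by rw [hn]; exact h) (n := 3) (by norm_num)
      rw [hn] at this
      simp only [Finset.sum_range_succ, Finset.sum_range_zero, hI] at this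
      norm_num at this
      have e : Complex.exp (Complex.I * α) - 1 - Complex.I * α + (α : ℂ) ^ 2 / 2
        = Complex.exp (Complex.I * α) - (1 + Complex.I * α + -(α : ℂ) ^ 2 / 2) := by ring
      rw [e]
      have h3 : 0 ≤ |α| ^ 3 := by positivity
      refine this.trans ?_
      linarith
  · have h1 : ‖Complex.exp (Complex.I * α) - 1‖ ≤ |α| := by
      simpa using Real.norm_exp_I_mul_ofReal_sub_one_le (x := α)
    have h2 : ‖Complex.exp (Complex.I * α) - 1 - Complex.I * α‖ ≤ 2 * |α| := by
      refine (norm_sub_le _ _).trans ?_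
      rw [hn]; linarith
    constructor
    · nlinarith
    · refine (norm_add_le _ _).trans ?_
      have : ‖(α : ℂ) ^ 2 / 2‖ = |α| ^ 2 / 2 := by simp
      rw [this]
      have : |α| ^ 2 ≤ |α| ^ 3 := pow_le_pow_right₀ h (by norm_num)
      nlinarith

/-- Third order expansion of the logarithm of the characteristic function of a geometric law. -/
lemma exists_geometric_charFun_eq_exp {a α : ℝ} (ha : 0 ≤ a) (h : a * |α| ≤ 1 / 2) :
    ∃ ε : ℂ, ‖ε‖ ≤ 4 * (a + a ^ 2 + a ^ 3) * |α| ^ 3 ∧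
      (1 - a * (Complex.exp (Complex.I * α) - 1))⁻¹
        = Complex.exp (Complex.I * (a * α : ℝ) - ((a + a ^ 2) * α ^ 2 / 2 : ℝ) + ε) := by
  set w : ℂ := Complex.exp (Complex.I * α) - 1 with hw
  set z : ℂ := a * w with hz
  have hw1 : ‖w‖ ≤ |α| := by
    simpa using Real.norm_exp_I_mul_ofReal_sub_one_le (x := α)
  have hz1 : ‖z‖ ≤ a * |α| := by
    rw [hz, norm_mul, Complex.norm_real, Real.norm_of_nonneg ha]
    gcongr
  have hz2 : ‖z‖ ≤ 1 / 2 := hz1.trans h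
  obtain ⟨hq, hc⟩ := norm_exp_I_sub_quadratic_le α
  refine ⟨Complex.log (1 - z)⁻¹ - (Complex.I * (a * α : ℝ) - ((a + a ^ 2) * α ^ 2 / 2 : ℝ)), ?_, ?_⟩
  · have hlog := Complex.norm_log_one_sub_inv_add_logTaylor_neg_le 2 (z := z) (by linarith)
    have hT : Complex.logTaylor (2 + 1) (-z) = -z - z ^ 2 / 2 := by
      simp [Complex.logTaylor, Finset.sum_range_succ]
      ring
    rw [hT] at hlog
    have hlog2 : ‖Complex.log (1 - z)⁻¹ + (-z - z ^ 2 / 2)‖ ≤ a ^ 3 * |α| ^ 3 := by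
      refine hlog.trans ?_
      have e1 : (1 - ‖z‖)⁻¹ ≤ 2 := by
        rw [inv_le_comm₀ (by linarith) (by norm_num)]; linarith
      have e2 : ‖z‖ ^ 3 ≤ (a * |α|) ^ 3 := by gcongr
      have e3 : ‖z‖ ^ 3 * (1 - ‖z‖)⁻¹ ≤ (a * |α|) ^ 3 * 2 :=
        mul_le_mul e2 e1 (inv_nonneg.mpr (by linarith)) (by positivity)
      have : 0 ≤ (a * |α|) ^ 3 := by positivity
      norm_num
      rw [← mul_pow]
      linarith
    have hlin : ‖(a : ℂ) * (w - Complex.I * α + (α : ℂ) ^ 2 / 2)‖ ≤ a * (4 * |α| ^ 3) := by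
      rw [norm_mul, Complex.norm_real, Real.norm_of_nonneg ha]
      gcongr
    have hsq : ‖(a : ℂ) ^ 2 / 2 * ((w - Complex.I * α) * (w + Complex.I * α))‖
        ≤ a ^ 2 / 2 * ((3 * |α| ^ 2) * (2 * |α|)) := by
      have e1 : ‖w + Complex.I * α‖ ≤ 2 * |α| := by
        refine (norm_add_le _ _).trans ?_
        have : ‖Complex.I * (α : ℂ)‖ = |α| := by simp
        linarith
      have e2 : ‖(a : ℂ) ^ 2 / 2‖ = a ^ 2 / 2 := by simp
      rw [norm_mul, norm_mul, e2]
      gcongr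
    have e : Complex.log (1 - z)⁻¹ - (Complex.I * (a * α : ℝ) - ((a + a ^ 2) * α ^ 2 / 2 : ℝ))
        = (Complex.log (1 - z)⁻¹ + (-z - z ^ 2 / 2))
          + (a : ℂ) * (w - Complex.I * α + (α : ℂ) ^ 2 / 2)
          + (a : ℂ) ^ 2 / 2 * ((w - Complex.I * α) * (w + Complex.I * α)) := by
      have hI : Complex.I ^ 2 = -1 := Complex.I_sq
      rw [hz]; push_cast
      linear_combination (a : ℂ) ^ 2 * (α : ℂ) ^ 2 / 2 * hI
    rw [e]
    refine (norm_add₃_le).trans ?_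
    have : 0 ≤ a ^ 3 * |α| ^ 3 := by positivity
    have : 0 ≤ a ^ 2 * |α| ^ 3 := by positivity
    nlinarith
  · rw [add_sub_cancel, Complex.exp_log]
    refine inv_ne_zero (sub_ne_zero.mpr ?_)
    intro h1
    rw [← h1] at hz2
    norm_num at hz2

/-- The characteristic function of `∑ j * G j`, the `G j` (`1 ≤ j ≤ K`) being independent
geometric with ratios `exp (-(j * s))`. -/
noncomputable def geomCharFun (K : ℕ) (s θ : ℝ) : ℂ :=
  ∏ j ∈ Finset.range K, (1 - (occ (((j : ℝ) + 1) * s) : ℂ)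
    * (Complex.exp (Complex.I * (((j : ℝ) + 1) * θ : ℝ)) - 1))⁻¹

lemma exists_geomCharFun_eq_exp {s θ : ℝ} (hs : 0 < s) (hθ : |θ| ≤ s / 8) (K : ℕ) :
    ∃ ε : ℂ, ‖ε‖ ≤ 3072 * |θ| ^ 3 / s ^ 4 ∧
      geomCharFun K s θ
        = Complex.exp (Complex.I * (meanOcc K s * θ : ℝ) - (varOcc K s * θ ^ 2 / 2 : ℝ) + ε) := by
  have key : ∀ j : ℕ, ∃ ε : ℂ, ‖ε‖ ≤ 4 * (occ (((j : ℝ) + 1) * s) + occ (((j : ℝ) + 1) * s) ^ 2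
        + occ (((j : ℝ) + 1) * s) ^ 3) * |((j : ℝ) + 1) * θ| ^ 3 ∧
      (1 - (occ (((j : ℝ) + 1) * s) : ℂ)
        * (Complex.exp (Complex.I * (((j : ℝ) + 1) * θ : ℝ)) - 1))⁻¹
        = Complex.exp (Complex.I * (occ (((j : ℝ) + 1) * s) * (((j : ℝ) + 1) * θ) : ℝ)
          - ((occ (((j : ℝ) + 1) * s) + occ (((j : ℝ) + 1) * s) ^ 2)
            * (((j : ℝ) + 1) * θ) ^ 2 / 2 : ℝ) + ε) := by
    intro j
    have hx : 0 < ((j : ℝ) + 1) * s := by positivity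
    refine exists_geometric_charFun_eq_exp (occ_pos hx).le ?_
    have h1 := mul_occ_le hx
    have h2 : Real.exp (-(3 / 4 * (((j : ℝ) + 1) * s))) ≤ 1 :=
      Real.exp_le_one_iff.mpr (by linarith)
    rw [abs_mul, abs_of_pos (show (0 : ℝ) < (j : ℝ) + 1 by positivity)]
    have h3 := (occ_pos hx).le
    calc _ ≤ occ (((j : ℝ) + 1) * s) * (((j : ℝ) + 1) * (s / 8)) := by gcongr
      _ = (((j : ℝ) + 1) * s * occ (((j : ℝ) + 1) * s)) / 8 := by ring
      _ ≤ 1 / 2 := by linarith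
  choose ε hε1 hε2 using key
  refine ⟨∑ j ∈ Finset.range K, ε j, ?_, ?_⟩
  · refine (norm_sum_le _ _).trans ((Finset.sum_le_sum fun j _ => hε1 j).trans ?_)
    have h := sum_range_cube_le hs K
    have h0 : 0 ≤ 4 * |θ| ^ 3 := by positivity
    have h1 := mul_le_mul_of_nonneg_left h h0
    rw [Finset.mul_sum] at h1
    convert! h1 using 1
    · refine Finset.sum_congr rfl fun j _ => ?_
      rw [abs_mul, abs_of_pos (show (0 : ℝ) < (j : ℝ) + 1 by positivity)]
      ring
    · ring
  · rw [geomCharFun, Finset.prod_congr rfl fun j _ => hε2 j, ← Complex.exp_sum]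
    congr 1
    rw [Finset.sum_add_distrib, Finset.sum_sub_distrib, meanOcc, varOcc]
    congr 2
    · push_cast
      rw [Finset.sum_mul, Finset.mul_sum]
      exact Finset.sum_congr rfl fun j _ => by ring
    · push_cast
      rw [Finset.sum_mul, Finset.sum_div]
      exact Finset.sum_congr rfl fun j _ => by ring

lemma normSq_one_sub_geometric (a α : ℝ) :
    Complex.normSq (1 - a * (Complex.exp (Complex.I * α) - 1))
      = 1 + 2 * a * (1 + a) * (1 - Real.cos α) := by
  have h1 : Complex.exp (Complex.I * α) = Real.cos α + Real.sin α * Complex.I := by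
    rw [mul_comm, Complex.exp_mul_I]; simp
  rw [h1, Complex.normSq_apply]
  simp
  have := Real.sin_sq_add_cos_sq α
  have h2 : Complex.cos α = (Real.cos α : ℂ) := by simp
  have h3 : Complex.sin α = (Real.sin α : ℂ) := by simp
  rw [h2, h3]
  simp only [Complex.ofReal_re]
  linear_combination a ^ 2 * this

lemma norm_geometric_charFun_le_one {a : ℝ} (ha : 0 ≤ a) (α : ℝ) :
    ‖(1 - a * (Complex.exp (Complex.I * α) - 1))⁻¹‖ ≤ 1 := by
  rw [norm_inv]
  refine inv_le_one_of_one_le₀ ?_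
  rw [← one_le_sq_iff₀ (norm_nonneg _), ← Complex.normSq_eq_norm_sq, normSq_one_sub_geometric]
  have : 0 ≤ 1 - Real.cos α := by linarith [Real.cos_le_one α]
  have : 0 ≤ 2 * a * (1 + a) * (1 - Real.cos α) := by positivity
  linarith

lemma norm_geometric_charFun_le_exp {a : ℝ} (ha : 1 / 2 ≤ a) (α : ℝ) :
    ‖(1 - a * (Complex.exp (Complex.I * α) - 1))⁻¹‖ ≤ Real.exp (-((1 - Real.cos α) / 6)) := by
  have h0 : 0 ≤ 1 - Real.cos α := by linarith [Real.cos_le_one α]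
  have h2 : 1 - Real.cos α ≤ 2 := by linarith [Real.neg_one_le_cos α]
  set y := 1 - Real.cos α
  refine (pow_le_pow_iff_left₀ (norm_nonneg _) (Real.exp_pos _).le two_ne_zero).mp ?_
  rw [norm_inv, inv_pow, ← Complex.normSq_eq_norm_sq, normSq_one_sub_geometric, ← Real.exp_nat_mul]
  have h1 : 1 - y / 3 ≤ Real.exp (-(y / 3)) := by linarith [Real.add_one_le_exp (-(y / 3))]
  have h3 : 1 + y ≤ 1 + 2 * a * (1 + a) * y := by
    have : 1 ≤ 2 * a * (1 + a) := by nlinarith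
    nlinarith
  have h4 : ((2 : ℕ) : ℝ) * -(y / 6) = -(y / 3) := by push_cast; ring
  rw [h4]
  calc _ ≤ (1 + y)⁻¹ := by gcongr
    _ ≤ 1 - y / 3 := by
      rw [inv_le_iff_one_le_mul₀ (by linarith)]
      nlinarith
    _ ≤ _ := h1

lemma two_mul_sin_mul_sum_cos (θ : ℝ) (J : ℕ) :
    2 * Real.sin (θ / 2) * ∑ j ∈ Finset.range J, Real.cos (((j : ℝ) + 1) * θ)
      = Real.sin (((J : ℝ) + 1 / 2) * θ) - Real.sin (θ / 2) := by
  induction J with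
  | zero => simp; ring_nf
  | succ n ih =>
    rw [Finset.sum_range_succ, mul_add, ih]
    have h1 : (((n + 1 : ℕ) : ℝ) + 1 / 2) * θ = ((n : ℝ) + 1) * θ + θ / 2 := by push_cast; ring
    have h2 : ((n : ℝ) + 1 / 2) * θ = ((n : ℝ) + 1) * θ - θ / 2 := by ring
    rw [h1, h2, Real.sin_add, Real.sin_sub]
    ring

lemma abs_sum_cos_le {θ : ℝ} (h0 : 0 < θ) (hπ : θ ≤ π) (J : ℕ) :
    ∑ j ∈ Finset.range J, Real.cos (((j : ℝ) + 1) * θ) ≤ π / (2 * θ) := by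
  have h1 := two_mul_sin_mul_sum_cos θ J
  have h2 : θ / π ≤ Real.sin (θ / 2) := by
    have := Real.mul_le_sin (x := θ / 2) (by linarith) (by linarith)
    convert! this using 1; ring
  have h3 : 0 < θ / π := by positivity
  have h4 : 2 * Real.sin (θ / 2) * ∑ j ∈ Finset.range J, Real.cos (((j : ℝ) + 1) * θ) ≤ 1 := by
    linarith [Real.sin_le_one (((J : ℝ) + 1 / 2) * θ)]
  by_contra! hc
  have h5 : 0 < π / (2 * θ) := by positivity
  have h6 : 2 * (θ / π) * (π / (2 * θ)) = 1 := by field_simp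
  have h7 : 2 * (θ / π) * (π / (2 * θ)) <
      2 * Real.sin (θ / 2) * ∑ j ∈ Finset.range J, Real.cos (((j : ℝ) + 1) * θ) :=
    mul_lt_mul' (by linarith) hc h5.le (by linarith)
  linarith

lemma min_le_sum_one_sub_cos {θ : ℝ} (hθ : |θ| ≤ π) (J : ℕ) :
    min (θ ^ 2 * J ^ 3 / 15) ((J : ℝ) / 2)
      ≤ ∑ j ∈ Finset.range J, (1 - Real.cos (((j : ℝ) + 1) * θ)) := by
  have hπ : π ^ 2 ≤ 10 := by have := Real.pi_lt_d2; have := Real.pi_pos; nlinarith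
  rcases le_total ((J : ℝ) * |θ|) π with h | h
  · refine (min_le_left _ _).trans ?_
    have h1 : θ ^ 2 * J ^ 3 / 15 ≤ ∑ j ∈ Finset.range J, θ ^ 2 / 5 * ((j : ℝ) + 1) ^ 2 := by
      rw [← Finset.mul_sum]
      have := cube_le_three_mul_sum_sq J
      have h2 : 0 ≤ θ ^ 2 := sq_nonneg _
      nlinarith
    refine h1.trans (Finset.sum_le_sum fun j hj => ?_)
    have hj' : (j : ℝ) + 1 ≤ J := by exact_mod_cast Finset.mem_range.mp hj
    have h2 : |((j : ℝ) + 1) * θ| ≤ π := by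
      rw [abs_mul, abs_of_pos (show (0 : ℝ) < (j : ℝ) + 1 by positivity)]
      exact (mul_le_mul_of_nonneg_right hj' (abs_nonneg _)).trans h
    have h3 := Real.cos_le_one_sub_mul_cos_sq h2
    have h4 : 1 / 5 ≤ 2 / π ^ 2 := by
      rw [div_le_div_iff₀ (by norm_num) (by positivity)]; linarith
    have h5 := mul_le_mul_of_nonneg_right h4 (sq_nonneg (((j : ℝ) + 1) * θ))
    nlinarith
  · refine (min_le_right _ _).trans ?_
    have hθ0 : 0 < |θ| := by
      rcases (abs_nonneg θ).eq_or_lt with h0 | h0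
      · rw [← h0, mul_zero] at h; exact absurd h (not_le.mpr Real.pi_pos)
      · exact h0
    have h1 := abs_sum_cos_le hθ0 hθ J
    have h2 : ∀ j : ℕ, Real.cos (((j : ℝ) + 1) * |θ|) = Real.cos (((j : ℝ) + 1) * θ) := by
      intro j
      rw [← Real.cos_abs (((j : ℝ) + 1) * θ), abs_mul,
        abs_of_pos (show (0 : ℝ) < (j : ℝ) + 1 by positivity)]
    simp only [h2] at h1
    rw [Finset.sum_sub_distrib]
    have h3 : π / (2 * |θ|) ≤ J / 2 := by
      rw [div_le_div_iff₀ (by positivity) (by norm_num)]; linarith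
    simp
    linarith

lemma norm_geomCharFun_le_exp {K J : ℕ} (hJK : J ≤ K) {s : ℝ} (hs : 0 < s) (hJ : J * s ≤ 1)
    (θ : ℝ) :
    ‖geomCharFun K s θ‖
      ≤ Real.exp (-((∑ j ∈ Finset.range J, (1 - Real.cos (((j : ℝ) + 1) * θ))) / 6)) := by
  rw [geomCharFun, norm_prod, ← Finset.prod_range_mul_prod_Ico _ hJK, Finset.sum_div,
    ← Finset.sum_neg_distrib, Real.exp_sum]
  rw [← mul_one (∏ j ∈ Finset.range J, Real.exp _)]
  refine mul_le_mul ?_ ?_ (Finset.prod_nonneg fun _ _ => norm_nonneg _)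
    (Finset.prod_nonneg fun _ _ => (Real.exp_pos _).le)
  · refine Finset.prod_le_prod (fun _ _ => norm_nonneg _) fun j hj => ?_
    have hj' : (j : ℝ) + 1 ≤ J := by exact_mod_cast Finset.mem_range.mp hj
    refine norm_geometric_charFun_le_exp (half_le_occ (by positivity) ?_) _
    exact (mul_le_mul_of_nonneg_right hj' hs.le).trans hJ
  · refine Finset.prod_le_one (fun _ _ => norm_nonneg _) fun j _ => ?_
    exact norm_geometric_charFun_le_one (occ_pos (by positivity)).le _

lemma norm_geomCharFun_le {K : ℕ} {s θ : ℝ} (hs : 0 < s) (hs1 : s ≤ 1) (hK : 1 ≤ K * s)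
    (hθ : |θ| ≤ π) :
    ‖geomCharFun K s θ‖ ≤ 5000000 * (1 + θ ^ 2 / s ^ 3)⁻¹ := by
  obtain ⟨J, hJ1, hJ2⟩ := exists_nat_half_inv hs hs1
  have hJK : J ≤ K := by
    have : (J : ℝ) ≤ K := le_of_mul_le_mul_right (hJ2.trans hK) hs
    exact_mod_cast this
  refine (norm_geomCharFun_le_exp hJK hs hJ2 θ).trans ?_
  have hS := min_le_sum_one_sub_cos hθ J
  set S := ∑ j ∈ Finset.range J, (1 - Real.cos (((j : ℝ) + 1) * θ))
  set u := θ ^ 2 / s ^ 3 with hu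
  have hu0 : 0 ≤ u := by positivity
  rw [← div_eq_mul_inv, le_div_iff₀ (by linarith)]
  rcases min_le_iff.mp hS with h | h
  · have h1 : u / 120 ≤ S := by
      have : (1 / (2 * s)) ^ 3 ≤ (J : ℝ) ^ 3 := by gcongr
      have e : u / 120 = θ ^ 2 * (1 / (2 * s)) ^ 3 / 15 := by rw [hu]; field_simp; ring
      rw [e]
      refine le_trans ?_ h
      gcongr
    have h2 : Real.exp (-(S / 6)) ≤ (1 + u / 720)⁻¹ := by
      rw [Real.exp_neg]
      have := Real.add_one_le_exp (S / 6)
      exact inv_anti₀ (by positivity) (by linarith)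
    calc _ ≤ (1 + u / 720)⁻¹ * (1 + u) := by gcongr
      _ ≤ 720 := by
        rw [inv_mul_le_iff₀ (by positivity)]; linarith
      _ ≤ _ := by norm_num
  · have h1 : 1 / (4 * s) ≤ S := by
      have e : 1 / (4 * s) = 1 / (2 * s) / 2 := by field_simp; norm_num
      linarith
    have h2 : (1 / (24 * s)) ^ 3 / 6 ≤ Real.exp (S / 6) := by
      have e : 1 / (24 * s) = 1 / (4 * s) / 6 := by field_simp; norm_num
      have h3 := Real.pow_div_factorial_le_exp (1 / (24 * s)) (by positivity) 3
      rw [show ((Nat.factorial 3 : ℕ) : ℝ) = 6 by norm_num [Nat.factorial]] at h3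
      refine h3.trans (Real.exp_le_exp.mpr ?_)
      rw [e]; linarith
    have h4 : Real.exp (-(S / 6)) ≤ 6 * 24 ^ 3 * s ^ 3 := by
      rw [Real.exp_neg]
      refine (inv_anti₀ (by positivity) h2).trans (le_of_eq ?_)
      field_simp
    have hθ2 : θ ^ 2 ≤ 10 := by
      have h5 : θ ^ 2 ≤ π ^ 2 := by rw [← sq_abs θ]; gcongr
      have := Real.pi_lt_d2; have := Real.pi_pos; nlinarith
    calc _ ≤ 6 * 24 ^ 3 * s ^ 3 * (1 + u) := by gcongr
      _ = 6 * 24 ^ 3 * (s ^ 3 + θ ^ 2) := by rw [hu]; field_simp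
      _ ≤ 6 * 24 ^ 3 * (1 ^ 3 + 10) := by gcongr
      _ ≤ _ := by norm_num

/-- The number of partitions of `n` into parts of size at most `K`. -/
def boundedPartitionCount (K n : ℕ) : ℕ := (Nat.Partition.restricted n (· ≤ K)).card

section GeneratingFunction

open PowerSeries

theorem mk_dvd_mul_one_sub_X_pow {d : ℕ} (hd : 0 < d) :
    (PowerSeries.mk fun n => if d ∣ n then (1 : ℂ) else 0) * (1 - X ^ d) = 1 := by
  ext n
  rw [mul_sub, mul_one, map_sub, coeff_mul_X_pow', coeff_mk, coeff_mk, coeff_one]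
  rcases lt_or_ge n d with h | h
  · rw [if_neg (not_le.2 h), sub_zero]
    by_cases h0 : n = 0
    · simp [h0]
    · rw [if_neg h0, if_neg (fun h' => absurd (Nat.le_of_dvd (Nat.pos_of_ne_zero h0) h') (by omega))]
  · rw [if_pos h, if_neg (by omega : n ≠ 0)]
    simp only [Nat.dvd_sub_iff_left h dvd_rfl, sub_self]

open scoped PowerSeries.WithPiTopology in
theorem mk_boundedPartitionCount_eq_prod (K : ℕ) :
    (PowerSeries.mk fun n => (boundedPartitionCount K n : ℂ)) =
      ∏ j ∈ Finset.range K, PowerSeries.mk fun n => if j + 1 ∣ n then (1 : ℂ) else 0 := by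
  have h := Nat.Partition.hasProd_powerSeriesMk_card_restricted ℂ (· ≤ K)
  have h2 := hasProd_prod_of_ne_finset_one (s := Finset.range K)
    (L := .unconditional ℕ) (f := fun i => if i + 1 ≤ K then ∑' j : ℕ, (X : ℂ⟦X⟧) ^ ((i + 1) * j) else 1) (by
      intro b hb
      rw [if_neg]
      rw [Finset.mem_range] at hb
      omega)
  refine (h.unique h2).trans (Finset.prod_congr rfl fun j hj => ?_)
  rw [if_pos (Nat.succ_le_of_lt (Finset.mem_range.1 hj))]
  have h3 := WithPiTopology.tsum_pow_mul_one_sub_of_constantCoeff_eq_zero (R := ℂ)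
    (f := X ^ (j + 1)) (by simp)
  simp_rw [pow_mul]
  exact left_inv_eq_right_inv h3 (by rw [mul_comm]; exact mk_dvd_mul_one_sub_X_pow j.succ_pos)

theorem summable_norm_coeff_mul_and_tsum {F G : ℂ⟦X⟧} {z a b : ℂ}
    (hF : Summable fun n => ‖coeff n F * z ^ n‖) (hFa : ∑' n, coeff n F * z ^ n = a)
    (hG : Summable fun n => ‖coeff n G * z ^ n‖) (hGb : ∑' n, coeff n G * z ^ n = b) :
    (Summable fun n => ‖coeff n (F * G) * z ^ n‖) ∧
      ∑' n, coeff n (F * G) * z ^ n = a * b := by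
  have key : ∀ n, coeff n (F * G) * z ^ n = ∑ kl ∈ Finset.HasAntidiagonal.antidiagonal n,
      (coeff kl.1 F * z ^ kl.1) * (coeff kl.2 G * z ^ kl.2) := by
    intro n
    rw [coeff_mul, Finset.sum_mul]
    refine Finset.sum_congr rfl fun p hp => ?_
    rw [← Finset.HasAntidiagonal.mem_antidiagonal.1 hp, pow_add]
    ring
  simp_rw [key]
  constructor
  · exact summable_norm_sum_mul_antidiagonal_of_summable_norm
      (f := fun n => coeff n F * z ^ n) (g := fun n => coeff n G * z ^ n) hF hG
  · rw [← hFa, ← hGb]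
    exact (tsum_mul_tsum_eq_tsum_sum_antidiagonal_of_summable_norm
      (f := fun n => coeff n F * z ^ n) (g := fun n => coeff n G * z ^ n) hF hG).symm

theorem tsum_dvd_mul_pow {d : ℕ} (hd : 0 < d) {z : ℂ} (hz : ‖z‖ < 1) :
    ∑' n, (if d ∣ n then (1 : ℂ) else 0) * z ^ n = (1 - z ^ d)⁻¹ := by
  have h1 : ‖z ^ d‖ < 1 := by
    rw [norm_pow]; exact pow_lt_one₀ (norm_nonneg _) hz hd.ne'
  have hinj : Function.Injective fun k : ℕ => d * k := fun a b h => Nat.eq_of_mul_eq_mul_left hd h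
  refine HasSum.tsum_eq ((hinj.hasSum_iff ?_).1 ?_)
  · intro n hn
    rw [if_neg, zero_mul]
    rintro ⟨k, rfl⟩
    exact hn ⟨k, rfl⟩
  · simpa [Function.comp_def, pow_mul] using hasSum_geometric_of_norm_lt_one h1

theorem summable_norm_coeff_and_tsum_prod (K : ℕ) {z : ℂ} (hz : ‖z‖ < 1) :
    (Summable fun n => ‖(boundedPartitionCount K n : ℂ) * z ^ n‖) ∧
      ∑' n, (boundedPartitionCount K n : ℂ) * z ^ n =
        ∏ j ∈ Finset.range K, (1 - z ^ (j + 1))⁻¹ := by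
  suffices h : ∀ L : ℕ, (Summable fun n => ‖coeff n (∏ j ∈ Finset.range L,
      PowerSeries.mk fun n => if j + 1 ∣ n then (1 : ℂ) else 0) * z ^ n‖) ∧
      ∑' n, coeff n (∏ j ∈ Finset.range L,
        PowerSeries.mk fun n => if j + 1 ∣ n then (1 : ℂ) else 0) * z ^ n =
        ∏ j ∈ Finset.range L, (1 - z ^ (j + 1))⁻¹ by
    have := h K
    rw [← mk_boundedPartitionCount_eq_prod] at this
    simpa only [coeff_mk] using this
  intro L
  induction L with
  | zero =>
    have h0 : ∀ n, n ∉ ({0} : Finset ℕ) → coeff n (1 : ℂ⟦X⟧) * z ^ n = 0 := by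
      intro n hn
      rw [coeff_one, if_neg (by simpa using hn), zero_mul]
    simp only [Finset.range_zero, Finset.prod_empty]
    refine ⟨summable_of_ne_finset_zero (s := {0}) fun n hn => by rw [h0 n hn, norm_zero], ?_⟩
    rw [tsum_eq_sum h0]
    simp
  | succ L ih =>
    simp only [Finset.prod_range_succ]
    refine summable_norm_coeff_mul_and_tsum ih.1 ih.2 ?_ ?_
    · refine Summable.of_nonneg_of_le (fun _ => norm_nonneg _) (fun n => ?_)
        (summable_geometric_of_lt_one (norm_nonneg z) hz)
      rw [coeff_mk, norm_mul, norm_pow]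
      refine mul_le_of_le_one_left (by positivity) ?_
      split_ifs <;> simp
    · simpa only [coeff_mk] using tsum_dvd_mul_pow L.succ_pos hz

end GeneratingFunction

theorem integral_exp_I_mul_int (m n : ℕ) :
    ∫ θ in (-π)..π, Complex.exp (Complex.I * ((((m : ℝ) - n) * θ : ℝ) : ℂ)) =
      if m = n then (2 * π : ℂ) else 0 := by
  split_ifs with h
  · subst h
    simp
    norm_cast
    ring
  · have hc : Complex.I * ((m : ℂ) - n) ≠ 0 :=
      mul_ne_zero Complex.I_ne_zero (sub_ne_zero.2 (by exact_mod_cast h))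
    have := integral_exp_mul_complex (a := -π) (b := π) hc
    push_cast at this ⊢
    simp_rw [← mul_assoc]
    rw [this, div_eq_zero_iff]
    left
    rw [sub_eq_zero, Complex.exp_eq_exp_iff_exists_int]
    exact ⟨(m : ℤ) - n, by push_cast; ring⟩

theorem one_sub_occ_mul {x : ℝ} (hx : 0 < x) (w : ℂ) :
    (1 - (occ x : ℂ) * (w - 1))⁻¹ = ((1 - Real.exp (-x) : ℝ) : ℂ) * (1 - (Real.exp (-x) : ℂ) * w)⁻¹ := by
  have h1 : (0 : ℝ) < Real.exp x - 1 := by linarith [Real.add_one_lt_exp hx.ne']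
  have hE : (0 : ℝ) < Real.exp x := Real.exp_pos x
  have hE' : (Real.exp x : ℂ) ≠ 0 := by exact_mod_cast hE.ne'
  have h1' : (Real.exp x : ℂ) - 1 ≠ 0 := by exact_mod_cast h1.ne'
  have key : (1 - (occ x : ℂ) * (w - 1)) =
      (1 - (Real.exp (-x) : ℂ) * w) * ((1 - Real.exp (-x) : ℝ) : ℂ)⁻¹ := by
    rw [occ, Real.exp_neg]
    push_cast at *
    field_simp
    ring
  rw [key, mul_inv, inv_inv, mul_comm]

theorem geomCharFun_eq_prod (K : ℕ) {s : ℝ} (hs : 0 < s) (θ : ℝ) :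
    geomCharFun K s θ = ((∏ j ∈ Finset.range K, (1 - Real.exp (-(((j : ℝ) + 1) * s))) : ℝ) : ℂ) *
      ∏ j ∈ Finset.range K, (1 - Complex.exp (-s + Complex.I * θ) ^ (j + 1))⁻¹ := by
  rw [geomCharFun, Complex.ofReal_prod, ← Finset.prod_mul_distrib]
  refine Finset.prod_congr rfl fun j _ => ?_
  rw [one_sub_occ_mul (by positivity), ← Complex.exp_nat_mul, Complex.ofReal_exp, ← Complex.exp_add]
  congr 4
  push_cast
  ring

theorem integral_geomCharFun (K n : ℕ) {s : ℝ} (hs : 0 < s) :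
    ∫ θ in (-π)..π, geomCharFun K s θ * Complex.exp (-(Complex.I * ((n * θ : ℝ) : ℂ))) =
      ((2 * π * (boundedPartitionCount K n * Real.exp (-(n * s)) *
        ∏ j ∈ Finset.range K, (1 - Real.exp (-(((j : ℝ) + 1) * s)))) : ℝ) : ℂ) := by
  set P : ℂ := ((∏ j ∈ Finset.range K, (1 - Real.exp (-(((j : ℝ) + 1) * s))) : ℝ) : ℂ) with hP
  have hnorm : ∀ θ : ℝ, ‖Complex.exp (-s + Complex.I * θ)‖ = Real.exp (-s) := by
    intro θ
    simp [Complex.norm_exp]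
  have hlt : Real.exp (-s) < 1 := by rw [Real.exp_lt_one_iff]; linarith
  have hsum : Summable fun m : ℕ => ‖P‖ * (boundedPartitionCount K m * Real.exp (-s) ^ m) := by
    have := (summable_norm_coeff_and_tsum_prod K (z := Complex.exp (-s + Complex.I * (0 : ℝ)))
      (by rw [hnorm]; exact hlt)).1
    simp only [norm_mul, norm_pow, hnorm, Complex.norm_natCast] at this
    exact this.mul_left _
  have key : ∀ (m : ℕ) (θ : ℝ), P * (boundedPartitionCount K m *
      Complex.exp (-s + Complex.I * θ) ^ m) * Complex.exp (-(Complex.I * ((n * θ : ℝ) : ℂ))) =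
      P * (boundedPartitionCount K m * (Real.exp (-(m * s)) : ℂ)) *
        Complex.exp (Complex.I * ((((m : ℝ) - n) * θ : ℝ) : ℂ)) := by
    intro m θ
    rw [← Complex.exp_nat_mul, Complex.ofReal_exp, mul_assoc, mul_assoc, mul_assoc, mul_assoc,
      ← Complex.exp_add, ← Complex.exp_add]
    congr 3
    push_cast
    ring
  have hs1 := intervalIntegral.hasSum_integral_of_dominated_convergence (μ := MeasureTheory.volume)
    (a := -π) (b := π)
    (F := fun (m : ℕ) (θ : ℝ) => P * (boundedPartitionCount K m *
      Complex.exp (-s + Complex.I * θ) ^ m) * Complex.exp (-(Complex.I * ((n * θ : ℝ) : ℂ))))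
    (f := fun θ => geomCharFun K s θ * Complex.exp (-(Complex.I * ((n * θ : ℝ) : ℂ))))
    (fun m _ => ‖P‖ * (boundedPartitionCount K m * Real.exp (-s) ^ m))
    (fun m => (Continuous.aestronglyMeasurable (by fun_prop)))
    (fun m => Eventually.of_forall fun θ _ => by
      have : ‖Complex.exp (-(Complex.I * ((n * θ : ℝ) : ℂ)))‖ = 1 := by simp [Complex.norm_exp]
      simp only [norm_mul, norm_pow, hnorm, Complex.norm_natCast, this, mul_one, le_refl])
    (Eventually.of_forall fun θ _ => hsum)
    (by simp)
    (Eventually.of_forall fun θ _ => by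
      have h := summable_norm_coeff_and_tsum_prod K (z := Complex.exp (-s + Complex.I * θ))
        (by rw [hnorm]; exact hlt)
      rw [geomCharFun_eq_prod K hs, ← h.2]
      exact ((h.1.of_norm.hasSum.mul_left P).mul_right _))
  simp only [key, intervalIntegral.integral_const_mul, integral_exp_I_mul_int] at hs1
  rw [← hs1.tsum_eq, tsum_eq_single n (fun m hm => by rw [if_neg hm, mul_zero]), if_pos rfl, hP]
  push_cast
  ring

theorem exists_abs_meanOcc_sub_le : ∃ C : ℝ, 0 ≤ C ∧ ∀ q : ℝ, 0 < q → ∀ (K : ℕ) (E : ℝ),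
    Real.exp (-(K * q ^ 4 / 4)) ≤ E * q →
      |meanOcc K (q ^ 4) - π ^ 2 / 6 / (q ^ 4) ^ 2| * q ^ 6 ≤ (C + 16 / 3 * E ^ 3) * q := by
  obtain ⟨C, hC⟩ := le_meanOcc
  refine ⟨|C|, abs_nonneg C, fun q hq K E hE => ?_⟩
  have h1 := meanOcc_le (s := q ^ 4) (by positivity) K
  have h2 := hC (q ^ 4) (by positivity) K
  have h3 : (q ^ 4) ^ (5 / 4 : ℝ) = q ^ 5 := by
    rw [← Real.rpow_natCast q 4, ← Real.rpow_mul hq.le, ← Real.rpow_natCast q 5]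
    norm_num
  have h4 : Real.exp (-(3 / 4 * q ^ 4 * K)) ≤ (E * q) ^ 3 := by
    calc Real.exp (-(3 / 4 * q ^ 4 * K)) = Real.exp (-(K * q ^ 4 / 4)) ^ 3 := by
          rw [← Real.exp_nat_mul]; congr 1; push_cast; ring
      _ ≤ (E * q) ^ 3 := by gcongr
  rw [h3] at h2
  rw [abs_of_nonpos (by linarith)]
  have h5 : π ^ 2 / 6 / (q ^ 4) ^ 2 - meanOcc K (q ^ 4) ≤
      |C| / q ^ 5 + 16 / 3 / (q ^ 4) ^ 2 * (E * q) ^ 3 := by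
    have : C / q ^ 5 ≤ |C| / q ^ 5 := by gcongr; exact le_abs_self C
    have : 16 / 3 / (q ^ 4) ^ 2 * Real.exp (-(3 / 4 * q ^ 4 * K)) ≤
      16 / 3 / (q ^ 4) ^ 2 * (E * q) ^ 3 := by gcongr
    linarith
  calc -(meanOcc K (q ^ 4) - π ^ 2 / 6 / (q ^ 4) ^ 2) * q ^ 6
      ≤ (|C| / q ^ 5 + 16 / 3 / (q ^ 4) ^ 2 * (E * q) ^ 3) * q ^ 6 := by
        gcongr; linarith
    _ = (|C| + 16 / 3 * E ^ 3) * q := by field_simp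

theorem abs_varOcc_sub_le {q : ℝ} (hq : 0 < q) {K n : ℕ} (hKn : K ≤ n) {E : ℝ}
    (hE : Real.exp (-(K * q ^ 4 / 4)) ≤ E * q) :
    |(q ^ 4) ^ 3 * varOcc n (q ^ 4) - (q ^ 4) ^ 3 * varOcc K (q ^ 4)| ≤ 96 * E * q := by
  have h := sum_Ico_var_le (s := q ^ 4) (by positivity) hKn
  have h1 : varOcc n (q ^ 4) - varOcc K (q ^ 4) = ∑ j ∈ Finset.Ico K n, ((j : ℝ) + 1) ^ 2 *
      (occ (((j : ℝ) + 1) * q ^ 4) + occ (((j : ℝ) + 1) * q ^ 4) ^ 2) := by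
    rw [varOcc, varOcc, Finset.sum_Ico_eq_sub _ hKn]
  rw [← mul_sub, h1, abs_of_nonneg (mul_nonneg (by positivity) (Finset.sum_nonneg fun j _ => by
    have := occ_pos (x := ((j : ℝ) + 1) * q ^ 4) (by positivity)
    positivity))]
  calc _ ≤ (q ^ 4) ^ 3 * (96 / (q ^ 4) ^ 3 * Real.exp (-(1 / 4 * q ^ 4 * K))) := by gcongr
    _ = 96 * Real.exp (-(K * q ^ 4 / 4)) := by
        rw [show 1 / 4 * q ^ 4 * (K : ℝ) = K * q ^ 4 / 4 by ring]; field_simp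
    _ ≤ 96 * (E * q) := by gcongr
    _ = _ := by ring

theorem exists_geomCharFun_mul_exp_eq : ∃ C : ℝ, 0 ≤ C ∧ ∀ (q : ℝ) (K n : ℕ) (E t : ℝ), 0 < q →
    q ≤ 1 → π ^ 2 / 6 / (q ^ 4) ^ 2 = n → K ≤ n → Real.exp (-(K * q ^ 4 / 4)) ≤ E * q →
    |t| * q ^ 2 ≤ 1 / 8 → ∃ δ : ℂ,
      ‖δ‖ ≤ ((C + 16 / 3 * E ^ 3) * |t| + 48 * E * t ^ 2 + 3072 * |t| ^ 3) * q ∧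
      geomCharFun K (q ^ 4) (t * q ^ 6) * Complex.exp (-(Complex.I * ((n * (t * q ^ 6) : ℝ) : ℂ))) =
        (Real.exp (-((q ^ 4) ^ 3 * varOcc n (q ^ 4) / 2) * t ^ 2) : ℂ) * Complex.exp δ := by
  obtain ⟨C, hC0, hC⟩ := exists_abs_meanOcc_sub_le
  refine ⟨C, hC0, fun q K n E t hq hq1 hn hKn hE ht => ?_⟩
  obtain ⟨ε, hε, hG⟩ := exists_geomCharFun_eq_exp (s := q ^ 4) (θ := t * q ^ 6) (by positivity) (by
    rw [abs_mul, abs_of_pos (pow_pos hq 6)]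
    calc |t| * q ^ 6 = |t| * q ^ 2 * q ^ 4 := by ring
      _ ≤ 1 / 8 * q ^ 4 := by gcongr
      _ = _ := by ring) K
  have hM := hC q hq K E hE
  have hV := abs_varOcc_sub_le hq hKn hE
  rw [hn] at hM
  refine ⟨Complex.I * (((meanOcc K (q ^ 4) - n) * (t * q ^ 6) : ℝ) : ℂ) +
    (((q ^ 4) ^ 3 * varOcc n (q ^ 4) - (q ^ 4) ^ 3 * varOcc K (q ^ 4)) * t ^ 2 / 2 : ℝ) + ε, ?_, ?_⟩
  · have h1 : ‖Complex.I * (((meanOcc K (q ^ 4) - n) * (t * q ^ 6) : ℝ) : ℂ)‖ ≤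
        (C + 16 / 3 * E ^ 3) * q * |t| := by
      rw [norm_mul, Complex.norm_I, one_mul, Complex.norm_real, Real.norm_eq_abs, abs_mul, abs_mul,
        abs_of_pos (pow_pos hq 6)]
      calc _ = |meanOcc K (q ^ 4) - n| * q ^ 6 * |t| := by ring
        _ ≤ _ := by gcongr
    have h2 : ‖((((q ^ 4) ^ 3 * varOcc n (q ^ 4) - (q ^ 4) ^ 3 * varOcc K (q ^ 4)) * t ^ 2 / 2
        : ℝ) : ℂ)‖ ≤ 96 * E * q * t ^ 2 / 2 := by
      rw [Complex.norm_real, Real.norm_eq_abs, abs_div, abs_mul, abs_of_nonneg (sq_nonneg t),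
        abs_of_pos (two_pos : (0 : ℝ) < 2)]
      gcongr
    have h3 : ‖ε‖ ≤ 3072 * |t| ^ 3 * q := by
      refine hε.trans ?_
      rw [abs_mul, abs_of_pos (pow_pos hq 6)]
      calc 3072 * (|t| * q ^ 6) ^ 3 / (q ^ 4) ^ 4 = 3072 * |t| ^ 3 * (q * q) := by field_simp
        _ ≤ 3072 * |t| ^ 3 * (q * 1) := by gcongr
        _ = _ := by ring
    calc _ ≤ (C + 16 / 3 * E ^ 3) * q * |t| + 96 * E * q * t ^ 2 / 2 + 3072 * |t| ^ 3 * q :=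
          (norm_add_le _ _).trans (add_le_add ((norm_add_le _ _).trans (add_le_add h1 h2)) h3)
      _ = _ := by ring
  · rw [hG, Complex.ofReal_exp, ← Complex.exp_add, ← Complex.exp_add]
    congr 1
    push_cast
    ring

theorem integral_gaussian_half (w : ℝ) :
    ∫ t : ℝ, (Real.exp (-(w / 2) * t ^ 2) : ℂ) = (√(2 * π / w) : ℝ) := by
  rw [integral_complex_ofReal, integral_gaussian]
  congr 2
  rw [div_div_eq_mul_div, mul_comm]

/-- Fourier coefficient of the tilted partition generating function, at the scale `q ^ 6` of the
Gaussian limit. -/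
noncomputable def scaledCoeff (q : ℝ) (K n : ℕ) : ℝ :=
  2 * π * (boundedPartitionCount K n * Real.exp (-(n * q ^ 4)) *
    ∏ j ∈ Finset.range K, (1 - Real.exp (-(((j : ℝ) + 1) * q ^ 4)))) / q ^ 6

theorem continuous_geomCharFun (K : ℕ) {s : ℝ} (hs : 0 < s) : Continuous (geomCharFun K s) := by
  have h : geomCharFun K s = fun θ : ℝ => ((∏ j ∈ Finset.range K,
      (1 - Real.exp (-(((j : ℝ) + 1) * s))) : ℝ) : ℂ) *
      ∏ j ∈ Finset.range K, (1 - Complex.exp (-s + Complex.I * θ) ^ (j + 1))⁻¹ :=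
    funext fun θ => geomCharFun_eq_prod K hs θ
  rw [h]
  refine continuous_const.mul (continuous_finsetProd _ fun j _ => Continuous.inv₀ (by fun_prop) ?_)
  intro θ h0
  have h1 : ‖Complex.exp (-s + Complex.I * θ) ^ (j + 1)‖ < 1 := by
    rw [norm_pow]
    refine pow_lt_one₀ (norm_nonneg _) ?_ j.succ_ne_zero
    simp [Complex.norm_exp, hs]
  rw [← sub_eq_zero.1 h0] at h1
  simp at h1

theorem integral_indicator_geomCharFun {q : ℝ} (hq : 0 < q) (K n : ℕ) :
    ∫ t : ℝ, (Set.Ioc (-π / q ^ 6) (π / q ^ 6)).indicator (fun t : ℝ =>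
      geomCharFun K (q ^ 4) (t * q ^ 6) *
        Complex.exp (-(Complex.I * ((n * (t * q ^ 6) : ℝ) : ℂ)))) t = (scaledCoeff q K n : ℂ) := by
  have h6 : 0 < q ^ 6 := by positivity
  rw [MeasureTheory.integral_indicator measurableSet_Ioc, ← intervalIntegral.integral_of_le (by
    gcongr; linarith [pi_pos]),
    intervalIntegral.integral_comp_mul_right (fun θ => geomCharFun K (q ^ 4) θ *
      Complex.exp (-(Complex.I * ((n * θ : ℝ) : ℂ)))) h6.ne', div_mul_cancel₀ _ h6.ne',
    div_mul_cancel₀ _ h6.ne', integral_geomCharFun K n (by positivity), scaledCoeff,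
    Complex.real_smul, ← Complex.ofReal_mul]
  congr 1
  field_simp

theorem tendsto_scaledCoeff_sub {q : ℕ → ℝ} (hq0 : Tendsto q atTop (nhds 0))
    (hq : ∀ᶠ n in atTop, 0 < q n) (hn : ∀ᶠ n : ℕ in atTop, π ^ 2 / 6 / (q n ^ 4) ^ 2 = n)
    {K : ℕ → ℕ} (hKn : ∀ᶠ n in atTop, K n ≤ n) {E : ℝ}
    (hE : ∀ᶠ n in atTop, Real.exp (-(K n * q n ^ 4 / 4)) ≤ E * q n) :
    Tendsto (fun n => scaledCoeff (q n) (K n) n -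
      √(2 * π / ((q n ^ 4) ^ 3 * varOcc n (q n ^ 4)))) atTop (nhds 0) := by
  have hq1 : ∀ᶠ n in atTop, q n ≤ 1 := (hq0.eventually_lt_const one_pos).mono fun n h => h.le
  have hEq : Tendsto (fun n => E * q n) atTop (nhds 0) := by simpa using hq0.const_mul E
  have hKs : ∀ᶠ n in atTop, 1 ≤ (K n : ℝ) * q n ^ 4 := by
    filter_upwards [hE, hEq.eventually_lt_const (Real.exp_pos (-(1 / 4)))] with n h1 h2
    have := Real.exp_lt_exp.1 (h1.trans_lt h2)
    linarith
  have hw : ∀ᶠ n in atTop, 1 / 32 ≤ (q n ^ 4) ^ 3 * varOcc n (q n ^ 4) := by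
    filter_upwards [hq, hq1, hKs, hKn] with n h0 h1 h2 h3
    have := le_varOcc (s := q n ^ 4) (K := n) (by positivity) (pow_le_one₀ h0.le h1)
      (h2.trans (by gcongr))
    calc 1 / 32 = (q n ^ 4) ^ 3 * (1 / 32 / (q n ^ 4) ^ 3) := by field_simp
      _ ≤ _ := by gcongr
  set F : ℕ → ℝ → ℂ := fun n t =>
    (Set.Ioc (-π / q n ^ 6) (π / q n ^ 6)).indicator (fun t : ℝ =>
      geomCharFun (K n) (q n ^ 4) (t * q n ^ 6) *
        Complex.exp (-(Complex.I * ((n * (t * q n ^ 6) : ℝ) : ℂ)))) t with hF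
  set G : ℕ → ℝ → ℂ := fun n t =>
    (Real.exp (-((q n ^ 4) ^ 3 * varOcc n (q n ^ 4) / 2) * t ^ 2) : ℂ) with hG
  have hFm : ∀ᶠ n in atTop, MeasureTheory.AEStronglyMeasurable (F n) MeasureTheory.volume := by
    filter_upwards [hq] with n h0
    have := continuous_geomCharFun (K n) (s := q n ^ 4) (by positivity)
    exact (Continuous.aestronglyMeasurable (by fun_prop)).indicator measurableSet_Ioc
  have hGm : ∀ n, MeasureTheory.AEStronglyMeasurable (G n) MeasureTheory.volume :=
    fun n => Continuous.aestronglyMeasurable (by fun_prop)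
  have hFb : ∀ᶠ n in atTop, ∀ t, ‖F n t‖ ≤ 5000000 * (1 + t ^ 2)⁻¹ := by
    filter_upwards [hq, hq1, hKs] with n h0 h1 h2 t
    have h6 : 0 < q n ^ 6 := by positivity
    simp only [hF]
    by_cases ht : t ∈ Set.Ioc (-π / q n ^ 6) (π / q n ^ 6)
    · rw [Set.indicator_of_mem ht, norm_mul,
        show ‖Complex.exp (-(Complex.I * ((n * (t * q n ^ 6) : ℝ) : ℂ)))‖ = 1 by
          rw [← mul_neg, ← Complex.ofReal_neg, Complex.norm_exp_I_mul_ofReal], mul_one]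
      have h3 := norm_geomCharFun_le (s := q n ^ 4) (θ := t * q n ^ 6) (by positivity)
        (pow_le_one₀ h0.le h1) h2 (by
          rw [abs_le]
          exact ⟨by linarith [(div_lt_iff₀ h6).1 ht.1], (le_div_iff₀ h6).1 ht.2⟩)
      rwa [show (t * q n ^ 6) ^ 2 / (q n ^ 4) ^ 3 = t ^ 2 by field_simp] at h3
    · rw [Set.indicator_of_notMem ht, norm_zero]
      positivity
  have hGb : ∀ᶠ n in atTop, ∀ t, ‖G n t‖ ≤ Real.exp (-(1 / 64) * t ^ 2) := by
    filter_upwards [hw] with n h t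
    simp only [hG]
    rw [Complex.norm_real, Real.norm_eq_abs, abs_of_pos (Real.exp_pos _), Real.exp_le_exp]
    nlinarith [sq_nonneg t]
  have hFi : MeasureTheory.Integrable fun t : ℝ => 5000000 * (1 + t ^ 2)⁻¹ :=
    integrable_inv_one_add_sq.const_mul _
  have hGi : MeasureTheory.Integrable fun t : ℝ => Real.exp (-(1 / 64) * t ^ 2) :=
    integrable_exp_neg_mul_sq (by norm_num)
  have hlim : ∀ t, Tendsto (fun n => F n t - G n t) atTop (nhds 0) := by
    intro t
    obtain ⟨C, hC0, hC⟩ := exists_geomCharFun_mul_exp_eq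
    set B : ℝ := (C + 16 / 3 * E ^ 3) * |t| + 48 * E * t ^ 2 + 3072 * |t| ^ 3 with hB
    have hBq : Tendsto (fun n => B * q n) atTop (nhds 0) := by simpa using hq0.const_mul B
    have htq : Tendsto (fun n => |t| * q n ^ 2) atTop (nhds 0) := by
      simpa using (hq0.pow 2).const_mul |t|
    refine squeeze_zero_norm' (a := fun n => 2 * (B * q n)) ?_ (by simpa using hBq.const_mul 2)
    filter_upwards [hq, hq1, hn, hKn, hE, hw, hBq.eventually_le_const one_pos,
      htq.eventually_le_const (show (0 : ℝ) < 1 / 8 by norm_num)] with n h0 h1 h2 h3 h4 h5 h6 h7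
    obtain ⟨δ, hδ, hδ'⟩ := hC (q n) (K n) n E t h0 h1 h2 h3 h4 h7
    rw [← hB] at hδ
    have hmem : t ∈ Set.Ioc (-π / q n ^ 6) (π / q n ^ 6) := by
      have h6p : 0 < q n ^ 6 := by positivity
      have : |t| * q n ^ 6 < π := by
        calc |t| * q n ^ 6 = |t| * q n ^ 2 * q n ^ 4 := by ring
          _ ≤ 1 / 8 * 1 := by gcongr; exact pow_le_one₀ h0.le h1
          _ < π := by linarith [pi_gt_three]
      have := abs_lt.1 ((lt_div_iff₀ h6p).2 this)
      exact ⟨by rw [neg_div]; exact this.1, this.2.le⟩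
    simp only [hF, hG]
    rw [Set.indicator_of_mem hmem, hδ', ← mul_sub_one, norm_mul]
    have h8 : ‖(Real.exp (-((q n ^ 4) ^ 3 * varOcc n (q n ^ 4) / 2) * t ^ 2) : ℂ)‖ ≤ 1 := by
      rw [Complex.norm_real, Real.norm_eq_abs, abs_of_pos (Real.exp_pos _), Real.exp_le_one_iff]
      nlinarith [sq_nonneg t]
    have h9 := Complex.norm_exp_sub_one_le (x := δ) (hδ.trans h6)
    calc _ ≤ 1 * (2 * ‖δ‖) := by gcongr
      _ ≤ _ := by linarith
  have hDCT := MeasureTheory.tendsto_integral_filter_of_dominated_convergence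
    (μ := MeasureTheory.volume) (F := fun n t => F n t - G n t) (f := fun _ => 0)
    (fun t => 5000000 * (1 + t ^ 2)⁻¹ + Real.exp (-(1 / 64) * t ^ 2))
    (hFm.mono fun n h => h.sub (hGm n))
    (by filter_upwards [hFb, hGb] with n h1 h2
        exact Eventually.of_forall fun t => (norm_sub_le _ _).trans (add_le_add (h1 t) (h2 t)))
    (hFi.add hGi) (Eventually.of_forall hlim)
  rw [MeasureTheory.integral_zero] at hDCT
  have hre := (Complex.continuous_re.tendsto 0).comp hDCT
  rw [Complex.zero_re] at hre
  refine hre.congr' ?_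
  filter_upwards [hq, hFm, hFb, hGb] with n h0 h1 h2 h3
  simp only [Function.comp]
  rw [MeasureTheory.integral_sub (hFi.mono' h1 (Eventually.of_forall h2))
    (hGi.mono' (hGm n) (Eventually.of_forall h3))]
  simp only [hF, hG]
  rw [integral_indicator_geomCharFun h0, integral_gaussian_half, ← Complex.ofReal_sub,
    Complex.ofReal_re]

/-- The scale `√(6 * n) / π` of the fluctuations of the largest part. -/
noncomputable def partScale (n : ℕ) : ℝ := √(6 * n) / π

/-- The integer threshold for the largest part corresponding to the limit variable `x`. -/
noncomputable def cutoff (x : ℝ) (n : ℕ) : ℕ :=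
  ⌊partScale n * Real.log (partScale n) + x * partScale n⌋₊

theorem tendsto_partScale : Tendsto partScale atTop atTop :=
  (tendsto_sqrt_atTop.comp (tendsto_natCast_atTop_atTop.const_mul_atTop (by norm_num))).atTop_div_const
    pi_pos

theorem partScale_sq (n : ℕ) : π ^ 2 / 6 * partScale n ^ 2 = n := by
  rw [partScale, div_pow, Real.sq_sqrt (by positivity)]
  field_simp

theorem eventually_log_partScale_add_nonneg (x : ℝ) :
    ∀ᶠ n in atTop, 0 ≤ Real.log (partScale n) + x := by
  filter_upwards [(Real.tendsto_log_atTop.comp tendsto_partScale).eventually_ge_atTop (-x)] with n h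
  simp only [Function.comp] at h
  linarith

theorem cutoff_le_mul (x : ℝ) : ∀ᶠ n in atTop,
    (cutoff x n : ℝ) * (partScale n)⁻¹ ≤ Real.log (partScale n) + x := by
  filter_upwards [eventually_log_partScale_add_nonneg x, tendsto_partScale.eventually_gt_atTop 0]
    with n h hN
  rw [← div_eq_mul_inv, div_le_iff₀ hN]
  refine (Nat.floor_le ?_).trans (le_of_eq (by ring))
  calc 0 ≤ (Real.log (partScale n) + x) * partScale n := by positivity
    _ = _ := by ring

theorem lt_cutoff_mul (x : ℝ) : ∀ᶠ n in atTop,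
    Real.log (partScale n) + x - (partScale n)⁻¹ ≤ (cutoff x n : ℝ) * (partScale n)⁻¹ := by
  filter_upwards [tendsto_partScale.eventually_gt_atTop 0] with n hN
  have := Nat.lt_floor_add_one (partScale n * Real.log (partScale n) + x * partScale n)
  rw [← div_eq_mul_inv, le_div_iff₀ hN, sub_mul, inv_mul_cancel₀ hN.ne']
  change _ ≤ ((⌊partScale n * Real.log (partScale n) + x * partScale n⌋₊ : ℕ) : ℝ)
  linarith

theorem cutoff_le (x : ℝ) : ∀ᶠ n in atTop, cutoff x n ≤ n := by
  have h1 := tendsto_partScale.eventually (Real.isLittleO_log_id_atTop.bound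
    (show (0 : ℝ) < 1 / 2 by norm_num))
  filter_upwards [h1, tendsto_partScale.eventually_ge_atTop (2 * x), cutoff_le_mul x,
    tendsto_partScale.eventually_gt_atTop 0] with n h1 h2 h3 hN
  rw [Real.norm_eq_abs, id, Real.norm_eq_abs, abs_of_pos hN] at h1
  have h4 := le_abs_self (Real.log (partScale n))
  rw [← div_eq_mul_inv, div_le_iff₀ hN] at h3
  have h5 : (cutoff x n : ℝ) ≤ n := by
    calc (cutoff x n : ℝ) ≤ (Real.log (partScale n) + x) * partScale n := h3
      _ ≤ partScale n * partScale n := by gcongr; linarith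
      _ = 1 * partScale n ^ 2 := by ring
      _ ≤ π ^ 2 / 6 * partScale n ^ 2 := by gcongr; nlinarith [pi_gt_three]
      _ = n := partScale_sq n
  exact_mod_cast h5

theorem tendsto_inv_partScale : Tendsto (fun n => (partScale n)⁻¹) atTop (nhds 0) :=
  tendsto_inv_atTop_zero.comp tendsto_partScale

theorem tendsto_mul_exp_neg_cutoff (x : ℝ) :
    Tendsto (fun n => partScale n * Real.exp (-(cutoff x n * (partScale n)⁻¹))) atTop
      (nhds (Real.exp (-x))) := by
  have h1 : Tendsto (fun n => (cutoff x n : ℝ) * (partScale n)⁻¹ - Real.log (partScale n)) atTop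
      (nhds x) := by
    refine tendsto_of_tendsto_of_tendsto_of_le_of_le' (g := fun n => x - (partScale n)⁻¹)
      (h := fun _ => x) (by simpa using tendsto_inv_partScale.const_sub x) tendsto_const_nhds ?_ ?_
    · filter_upwards [lt_cutoff_mul x] with n h
      linarith
    · filter_upwards [cutoff_le_mul x] with n h
      linarith
  refine ((Real.continuous_exp.tendsto _).comp h1.neg).congr' ?_
  filter_upwards [tendsto_partScale.eventually_gt_atTop 0] with n hN
  simp only [Function.comp]
  rw [neg_sub, sub_eq_add_neg, Real.exp_add, Real.exp_log hN]

theorem tendsto_mul_exp_neg_self :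
    Tendsto (fun n : ℕ => partScale n * Real.exp (-(n * (partScale n)⁻¹))) atTop (nhds 0) := by
  have h := (Real.tendsto_pow_mul_exp_neg_atTop_nhds_zero 1).comp tendsto_partScale
  refine squeeze_zero' ?_ ?_ h
  · filter_upwards [tendsto_partScale.eventually_gt_atTop 0] with n hN
    positivity
  · filter_upwards [tendsto_partScale.eventually_gt_atTop 0] with n hN
    simp only [Function.comp, pow_one]
    gcongr
    rw [← div_eq_mul_inv, le_div_iff₀ hN]
    calc partScale n * partScale n = 1 * partScale n ^ 2 := by ring
      _ ≤ π ^ 2 / 6 * partScale n ^ 2 := by gcongr; nlinarith [pi_gt_three]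
      _ = n := partScale_sq n

theorem tendsto_mul_occ : Tendsto (fun s : ℝ => s * occ s) (nhdsWithin 0 {0}ᶜ) (nhds 1) := by
  have h := hasDerivAt_iff_tendsto_slope_zero.1 (Real.hasDerivAt_exp 0)
  rw [Real.exp_zero] at h
  simpa [occ, mul_comm] using h.inv₀ one_ne_zero

theorem sum_Ico_exp_eq {s : ℝ} (hs : 0 < s) {k n : ℕ} (hkn : k ≤ n) :
    ∑ j ∈ Finset.Ico k n, Real.exp (-(((j : ℝ) + 1) * s)) =
      (Real.exp (-(k * s)) - Real.exp (-(n * s))) * occ s := by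
  induction n, hkn using Nat.le_induction with
  | base => simp
  | succ n hkn ih =>
    rw [Finset.sum_Ico_succ_top hkn, ih]
    have h1 : Real.exp s - 1 ≠ 0 := by linarith [Real.add_one_lt_exp hs.ne']
    have h2 : Real.exp (-(n * s)) = Real.exp (-(((n : ℝ) + 1) * s)) * Real.exp s := by
      rw [← Real.exp_add]; congr 1; ring
    rw [h2, occ]
    push_cast
    field_simp
    ring

theorem prod_one_sub_le_exp_neg_sum {ι : Type*} (A : Finset ι) {y : ι → ℝ}
    (hy : ∀ i ∈ A, y i ≤ 1) : ∏ i ∈ A, (1 - y i) ≤ Real.exp (-∑ i ∈ A, y i) := by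
  rw [← Finset.sum_neg_distrib, Real.exp_sum]
  exact Finset.prod_le_prod (fun i hi => by linarith [hy i hi])
    fun i _ => Real.one_sub_le_exp_neg _

theorem exp_neg_sum_div_le_prod_one_sub {ι : Type*} (A : Finset ι) {y : ι → ℝ} {b : ℝ}
    (hb : b < 1) (hy0 : ∀ i ∈ A, 0 ≤ y i) (hy : ∀ i ∈ A, y i ≤ b) :
    Real.exp (-((∑ i ∈ A, y i) / (1 - b))) ≤ ∏ i ∈ A, (1 - y i) := by
  rw [Finset.sum_div, ← Finset.sum_neg_distrib, Real.exp_sum]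
  refine Finset.prod_le_prod (fun i _ => (Real.exp_pos _).le) fun i hi => ?_
  have h1 : 0 < 1 - y i := by linarith [hy i hi]
  have h2 : y i / (1 - y i) ≤ y i / (1 - b) :=
    div_le_div_of_nonneg_left (hy0 i hi) (by linarith) (by linarith [hy i hi])
  have h3 : (1 - y i)⁻¹ ≤ Real.exp (y i / (1 - b)) := by
    calc (1 - y i)⁻¹ = y i / (1 - y i) + 1 := by field_simp; ring
      _ ≤ y i / (1 - b) + 1 := by linarith
      _ ≤ _ := Real.add_one_le_exp _
  rw [Real.exp_neg]
  exact inv_le_of_inv_le₀ h1 h3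

theorem tendsto_prod_Ico_cutoff (x : ℝ) :
    Tendsto (fun n : ℕ => ∏ j ∈ Finset.Ico (cutoff x n) n,
      (1 - Real.exp (-(((j : ℝ) + 1) * (partScale n)⁻¹)))) atTop
      (nhds (Real.exp (-Real.exp (-x)))) := by
  have hpos := tendsto_partScale.eventually_gt_atTop 0
  have hinv : Tendsto (fun n => (partScale n)⁻¹) atTop (nhdsWithin 0 {0}ᶜ) :=
    tendsto_nhdsWithin_iff.2 ⟨tendsto_inv_partScale, hpos.mono fun n h => (inv_pos.2 h).ne'⟩
  have hS : Tendsto (fun n : ℕ => ∑ j ∈ Finset.Ico (cutoff x n) n,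
      Real.exp (-(((j : ℝ) + 1) * (partScale n)⁻¹))) atTop (nhds (Real.exp (-x))) := by
    have h := ((tendsto_mul_exp_neg_cutoff x).sub tendsto_mul_exp_neg_self).mul
      (tendsto_mul_occ.comp hinv)
    rw [sub_zero, mul_one] at h
    refine h.congr' ?_
    filter_upwards [hpos, cutoff_le x] with n hN hk
    rw [sum_Ico_exp_eq (inv_pos.2 hN) hk]
    simp only [Function.comp]
    field_simp
  have hb : Tendsto (fun n => Real.exp (-(cutoff x n * (partScale n)⁻¹))) atTop (nhds 0) := by
    have h := (tendsto_mul_exp_neg_cutoff x).mul tendsto_inv_partScale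
    rw [mul_zero] at h
    refine h.congr' ?_
    filter_upwards [hpos] with n hN
    field_simp
  have hlow := (Real.continuous_exp.tendsto _).comp
    (hS.div (hb.const_sub 1) (by norm_num)).neg
  rw [sub_zero, div_one] at hlow
  refine tendsto_of_tendsto_of_tendsto_of_le_of_le' hlow
    ((Real.continuous_exp.tendsto _).comp hS.neg) ?_ ?_
  · filter_upwards [hb.eventually_lt_const one_pos, hpos] with n h1 hN
    refine exp_neg_sum_div_le_prod_one_sub _ h1 (fun j _ => (Real.exp_pos _).le) fun j hj => ?_
    have : (cutoff x n : ℝ) ≤ j := by exact_mod_cast (Finset.mem_Ico.1 hj).1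
    gcongr
    linarith
  · filter_upwards [hpos] with n hN
    refine prod_one_sub_le_exp_neg_sum _ fun j _ => ?_
    rw [Real.exp_le_one_iff, neg_nonpos]
    positivity

theorem tendsto_scaledCoeff_div {q : ℕ → ℝ} (hq0 : Tendsto q atTop (nhds 0))
    (hq : ∀ᶠ n in atTop, 0 < q n) (hn : ∀ᶠ n : ℕ in atTop, π ^ 2 / 6 / (q n ^ 4) ^ 2 = n)
    {K : ℕ → ℕ} (hKn : ∀ᶠ n in atTop, K n ≤ n) {E : ℝ}
    (hE : ∀ᶠ n in atTop, Real.exp (-(K n * q n ^ 4 / 4)) ≤ E * q n) :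
    Tendsto (fun n => scaledCoeff (q n) (K n) n / scaledCoeff (q n) n n) atTop (nhds 1) := by
  have hE' : ∀ᶠ n : ℕ in atTop, Real.exp (-(n * q n ^ 4 / 4)) ≤ E * q n := by
    filter_upwards [hE, hKn, hq] with n h1 h2 h3
    refine le_trans ?_ h1
    gcongr
  have h1 := tendsto_scaledCoeff_sub hq0 hq hn hKn hE
  have h2 := tendsto_scaledCoeff_sub (K := fun n => n) hq0 hq hn (Eventually.of_forall fun n => le_rfl) hE'
  set m : ℝ := √(2 * π / 96) with hm
  have hm0 : 0 < m := by positivity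
  have hlow : ∀ᶠ n : ℕ in atTop, m / 2 ≤ scaledCoeff (q n) n n := by
    have hEq : Tendsto (fun n => E * q n) atTop (nhds 0) := by simpa using hq0.const_mul E
    filter_upwards [hq, h2.eventually_const_lt (show -(m / 2) < 0 by linarith), hE',
      hEq.eventually_lt_const (Real.exp_pos (-(1 / 4))),
      hq0.eventually_lt_const one_pos] with n h3 h4 h5 h6 h7
    have h8 := Real.exp_lt_exp.1 (h5.trans_lt h6)
    have h9 := le_varOcc (s := q n ^ 4) (K := n) (by positivity) (pow_le_one₀ h3.le h7.le)
      (by linarith)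
    have h10 : 0 < varOcc n (q n ^ 4) := lt_of_lt_of_le (by positivity) h9
    have : m ≤ √(2 * π / ((q n ^ 4) ^ 3 * varOcc n (q n ^ 4))) := by
      refine Real.sqrt_le_sqrt ?_
      gcongr
      have := varOcc_le (s := q n ^ 4) (by positivity) n
      rwa [le_div_iff₀ (by positivity), mul_comm] at this
    linarith
  have h3 : Tendsto (fun n => (scaledCoeff (q n) (K n) n - scaledCoeff (q n) n n) /
      scaledCoeff (q n) n n) atTop (nhds 0) := by
    have h4 : Tendsto (fun n => |scaledCoeff (q n) (K n) n - scaledCoeff (q n) n n| / (m / 2)) atTop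
        (nhds 0) := by
      have := (h1.sub h2).abs.div_const (m / 2)
      simpa using this
    refine squeeze_zero_norm' ?_ h4
    filter_upwards [hlow] with n h
    have : 0 < scaledCoeff (q n) n n := lt_of_lt_of_le (by positivity) h
    rw [norm_div, Real.norm_eq_abs, Real.norm_eq_abs, abs_of_pos this]
    gcongr
  have h5 := h3.add_const 1
  rw [zero_add] at h5
  refine h5.congr' ?_
  filter_upwards [hlow] with n h
  have : 0 < scaledCoeff (q n) n n := lt_of_lt_of_le (by positivity) h
  field_simp
  ring

theorem scaledCoeff_div_mul_prod {q : ℝ} (hq : 0 < q) {K n : ℕ} (hKn : K ≤ n) :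
    scaledCoeff q K n / scaledCoeff q n n *
      ∏ j ∈ Finset.Ico K n, (1 - Real.exp (-(((j : ℝ) + 1) * q ^ 4))) =
        boundedPartitionCount K n / boundedPartitionCount n n := by
  have hne : ∀ A : Finset ℕ, ∏ j ∈ A, (1 - Real.exp (-(((j : ℝ) + 1) * q ^ 4))) ≠ 0 := by
    intro A
    refine Finset.prod_ne_zero_iff.2 fun j _ => ?_
    have : Real.exp (-(((j : ℝ) + 1) * q ^ 4)) < 1 := by
      rw [Real.exp_lt_one_iff, neg_lt_zero]; positivity
    linarith
  rw [scaledCoeff, scaledCoeff, ← Finset.prod_range_mul_prod_Ico _ hKn]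
  have h1 := hne (Finset.range K)
  have h2 := hne (Finset.Ico K n)
  generalize ∏ j ∈ Finset.range K, (1 - Real.exp (-(((j : ℝ) + 1) * q ^ 4))) = A at h1 ⊢
  generalize ∏ j ∈ Finset.Ico K n, (1 - Real.exp (-(((j : ℝ) + 1) * q ^ 4))) = B at h2 ⊢
  field_simp

theorem tendsto_boundedPartitionCount_cutoff (x : ℝ) :
    Tendsto (fun n => (boundedPartitionCount (cutoff x n) n : ℝ) / boundedPartitionCount n n) atTop
      (nhds (Real.exp (-Real.exp (-x)))) := by
  have hpos := tendsto_partScale.eventually_gt_atTop 0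
  set q : ℕ → ℝ := fun n => √√(partScale n)⁻¹ with hqdef
  have hq4 : ∀ n, 0 < partScale n → q n ^ 4 = (partScale n)⁻¹ := by
    intro n h
    rw [hqdef, show 4 = 2 * 2 by rfl, pow_mul, Real.sq_sqrt (by positivity),
      Real.sq_sqrt (by positivity)]
  have hq : ∀ᶠ n in atTop, 0 < q n := by
    filter_upwards [hpos] with n h
    simp only [hqdef]
    positivity
  have hq0 : Tendsto q atTop (nhds 0) := by
    have := ((Real.continuous_sqrt.comp Real.continuous_sqrt).tendsto 0).comp tendsto_inv_partScale
    simpa [hqdef, Function.comp_def] using this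
  have hn : ∀ᶠ n : ℕ in atTop, π ^ 2 / 6 / (q n ^ 4) ^ 2 = n := by
    filter_upwards [hpos] with n h
    rw [hq4 n h, inv_pow, div_inv_eq_mul, partScale_sq]
  have hE : ∀ᶠ n in atTop, Real.exp (-(cutoff x n * q n ^ 4 / 4)) ≤
      Real.exp ((1 - x) / 4) * q n := by
    filter_upwards [hpos, hq, lt_cutoff_mul x,
      tendsto_inv_partScale.eventually_lt_const one_pos] with n h1 h2 h3 h4
    have h5 : 4 * Real.log (q n) = -Real.log (partScale n) := by
      rw [← Real.log_inv, ← hq4 n h1, Real.log_pow]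
      norm_num
    nth_rw 2 [← Real.exp_log h2]
    rw [← Real.exp_add, Real.exp_le_exp, hq4 n h1]
    linarith
  have h := (tendsto_scaledCoeff_div hq0 hq hn (cutoff_le x) hE).mul (tendsto_prod_Ico_cutoff x)
  rw [one_mul] at h
  refine h.congr' ?_
  filter_upwards [hpos, hq, cutoff_le x] with n h1 h2 h3
  rw [← scaledCoeff_div_mul_prod h2 h3, hq4 n h1]

theorem partitionCount_eq_boundedPartitionCount (n : ℕ) :
    partitionCount n = boundedPartitionCount n n := by
  rw [partitionCount, boundedPartitionCount, Nat.Partition.restricted, Nat.card_eq_fintype_card,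
    Finset.filter_true_of_mem fun P _ i hi => Nat.Partition.le_of_mem_parts hi, Finset.card_univ]

theorem card_largestPart_le (n K : ℕ) :
    Nat.card {P : n.Partition // P.largestPart ≤ K} = boundedPartitionCount K n := by
  classical
  rw [Nat.card_eq_fintype_card, Fintype.card_subtype, boundedPartitionCount,
    Nat.Partition.restricted]
  congr 1
  ext P
  simp [Nat.Partition.largestPart, Multiset.sup_le]

theorem erdos_lehner_largest_part (x : ℝ) :
    Tendsto
      (fun n : ℕ =>
        (Nat.card {P : n.Partition //
            ((P.largestPart : ℝ) - (Real.sqrt (6 * n) / π) * Real.log (Real.sqrt (6 * n) / π))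
              / (Real.sqrt (6 * n) / π) ≤ x} : ℝ)
          / (partitionCount n : ℝ))
      atTop (nhds (Real.exp (-Real.exp (-x)))) := by
  refine (tendsto_boundedPartitionCount_cutoff x).congr' ?_
  filter_upwards [tendsto_partScale.eventually_gt_atTop 0, eventually_log_partScale_add_nonneg x]
    with n hN hx
  rw [partitionCount_eq_boundedPartitionCount, ← card_largestPart_le n (cutoff x n)]
  congr 2
  refine Nat.card_congr (Equiv.subtypeEquivRight fun P => ?_)
  change _ ↔ ((P.largestPart : ℝ) - partScale n * Real.log (partScale n)) / partScale n ≤ x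
  have h0 : 0 ≤ partScale n * Real.log (partScale n) + x * partScale n := by
    calc 0 ≤ (Real.log (partScale n) + x) * partScale n := by positivity
      _ = _ := by ring
  rw [cutoff, Nat.le_floor_iff h0, div_le_iff₀ hN, sub_le_iff_le_add']
end
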